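/- Let (W, S) be a simply laced Coxeter system (m(s,t) ∈ {2,3} for all s ≠ t in S), H ⊆ S, and x ∈ {q, −1}. For every refinement ℳ of the pircon W^H with ℳ ⊆ SPM^H, the Kazhdan–Lusztig R^x-polynomials of the refined pircon (W^H, ℳ) coincide with Deodhar's parabolic Kazhdan–Lusztig R-polynomials of type x: R^x_{u,w}(q) = R^{H,x}_{u,w}(q) for all u, w ∈ W^H. -/

import Mathlib

open Polynomial

section Bruhat

variable {B : Type*} {W : Type*} [Group W] {Mat : CoxeterMatrix B} (cs : CoxeterSystem Mat W)

/-- One step of the Bruhat order on a Coxeter group: multiply on the right by a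
reflection and increase the length. -/
def bstep (u v : W) : Prop :=
  (∃ t : W, cs.IsReflection t ∧ v = u * t) ∧ cs.length u < cs.length v

/-- The Bruhat order `≤` on the Coxeter group `W`. -/
def ble (u v : W) : Prop :=
  Relation.ReflTransGen (bstep cs) u v

/-- Strict Bruhat order. -/
def blt (u v : W) : Prop := ble cs u v ∧ u ≠ v

/-- Covering relation of the Bruhat order. -/
def bcov (u v : W) : Prop :=
  blt cs u v ∧ ∀ z : W, ble cs u z → ble cs z v → z = u ∨ z = v

/-- The set `W^H` of minimal coset representatives:
`w` with `ℓ(w s) > ℓ(w)` for all `s ∈ H`. -/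
def WH (H : Set B) : Set W :=
  {w | ∀ i ∈ H, cs.length w < cs.length (w * cs.simple i)}

end Bruhat

attribute [local instance] Classical.propDecidable

section Matchings

variable {B : Type*} {W : Type*} [Group W] {Mat : CoxeterMatrix B} (cs : CoxeterSystem Mat W)

/-- A special matching of the Bruhat interval `[e,w]`, encoded as a total function
`M : W → W` whose values outside `[e,w]` are irrelevant. -/
def IsSpecialMatching (w : W) (M : W → W) : Prop :=
  (∀ x, ble cs x w → ble cs (M x) w) ∧
  (∀ x, ble cs x w → M (M x) = x) ∧
  (∀ x, ble cs x w → (bcov cs (M x) x ∨ bcov cs x (M x))) ∧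
  (∀ u v, ble cs u w → ble cs v w → bcov cs u v → M u ≠ v → ble cs (M u) (M v))

/-- An `H`-special matching of `[e,w]`. -/
def IsHSpecial (H : Set B) (w : W) (M : W → W) : Prop :=
  IsSpecialMatching cs w M ∧
  ∀ u, ble cs u w → u ∈ WH cs H → bcov cs (M u) u → M u ∈ WH cs H

/-- `x` is covered by `y` inside the subposet induced by the Bruhat order on `O`. -/
def CovInB (O : Set W) (x y : W) : Prop :=
  x ∈ O ∧ y ∈ O ∧ blt cs x y ∧ ∀ z ∈ O, ¬ (blt cs x z ∧ blt cs z y)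

/-- The map `M^H` obtained from an `H`-special matching `M`: `M^H x = M x` if
`M x ∈ W^H`, and `M^H x = x` otherwise. -/
noncomputable def MHmap (H : Set B) (M : W → W) : W → W :=
  fun x => if M x ∈ WH cs H then M x else x

/-- A special partial matching of the subposet induced on the set `Q` (with top `t`):
`M` maps `Q` to itself, is an involution on `Q`, `M t` is covered by `t` in `Q`, every
element of `Q` is moved to a covered, equal or covering element of `Q`, and whenever
`x ⋖ y` in `Q` with `M x ≠ y` one has `M x < M y`. -/
def IsSPMOnSet (Q : Set W) (t : W) (M : W → W) : Prop :=
  (∀ x ∈ Q, M x ∈ Q) ∧ (∀ x ∈ Q, M (M x) = x) ∧ CovInB cs Q (M t) t ∧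
  (∀ x ∈ Q, (CovInB cs Q (M x) x ∨ M x = x ∨ CovInB cs Q x (M x))) ∧
  (∀ x ∈ Q, ∀ y ∈ Q, CovInB cs Q x y → M x ≠ y → blt cs (M x) (M y))

/-- The set `SPM^H` of all special partial matchings of the posets `[e,w]^H`
(`w ∈ W^H`, `w ≠ e`) obtained from `H`-special matchings via `M ↦ M^H`. -/
noncomputable def SPMH (H : Set B) : Set (W × (W → W)) :=
  {p | ∃ (w' : W) (M : W → W),
    p = (w', MHmap cs H M) ∧ w' ∈ WH cs H ∧ w' ≠ 1 ∧ IsHSpecial cs H w' M}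

/-- `R` is the family of Kazhdan–Lusztig `R^x`-polynomials of the refined pircon
`(Q, ℳ)`, where `Q` is a subposet of `W` with the Bruhat order, `ℳ w` is the chosen
special partial matching of each non-minimal `w ∈ Q`, `q = X` and `x ∈ {q, -1}`. -/
def IsKLFamilyOnSet (Q : Set W) (ℳ : W → W → W) (x : Polynomial ℤ)
    (R : W → W → Polynomial ℤ) : Prop :=
  (∀ w ∈ Q, R w w = 1) ∧
  (∀ u ∈ Q, ∀ w ∈ Q, ¬ ble cs u w → R u w = 0) ∧
  ∀ u ∈ Q, ∀ w ∈ Q, blt cs u w →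
    (CovInB cs Q (ℳ w u) u → R u w = R (ℳ w u) (ℳ w w)) ∧
    (CovInB cs Q u (ℳ w u) →
      R u w = (X - 1) * R u (ℳ w w) + X * R (ℳ w u) (ℳ w w)) ∧
    (ℳ w u = u → R u w = (X - 1 - x) * R u (ℳ w w))

/-- `RH` is Deodhar's family of parabolic Kazhdan–Lusztig `R`-polynomials of `W^H` of
type `x ∈ {q, -1}` (with `q = X`), characterized by the left-multiplication
recursion. -/
def IsDeodharFamily (H : Set B) (x : Polynomial ℤ)
    (RH : W → W → Polynomial ℤ) : Prop :=
  (∀ u ∈ WH cs H, ∀ v ∈ WH cs H, ¬ ble cs u v → RH u v = 0) ∧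
  (∀ u ∈ WH cs H, RH u u = 1) ∧
  ∀ u ∈ WH cs H, ∀ v ∈ WH cs H, blt cs u v →
    ∀ i : B, cs.length (cs.simple i * v) < cs.length v →
      (cs.length (cs.simple i * u) < cs.length u →
        RH u v = RH (cs.simple i * u) (cs.simple i * v)) ∧
      (cs.length u < cs.length (cs.simple i * u) → cs.simple i * u ∈ WH cs H →
        RH u v = (X - 1) * RH u (cs.simple i * v)
          + X * RH (cs.simple i * u) (cs.simple i * v)) ∧
      (cs.length u < cs.length (cs.simple i * u) → cs.simple i * u ∉ WH cs H →
        RH u v = (X - 1 - x) * RH u (cs.simple i * v))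

end Matchings

section ReflectionCocycle

variable {B : Type*} {W : Type*} [Group W] {Mat : CoxeterMatrix B} (cs : CoxeterSystem Mat W)

/-- The action of a simple reflection on `W × ZMod 2`: conjugation on the first factor, with a
change of sign at the reflection itself. -/
noncomputable def signedConj (i : B) : Function.End (W × ZMod 2) :=
  fun p => (cs.simple i * p.1 * cs.simple i, p.2 + if p.1 = cs.simple i then 1 else 0)

lemma signedConj_mul_pow (i j : B) (k : ℕ) (p : W × ZMod 2) :
    ((signedConj cs i * signedConj cs j) ^ k) p =
      ((cs.simple i * cs.simple j) ^ k * p.1 * ((cs.simple i * cs.simple j) ^ k)⁻¹,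
        p.2 + ∑ l ∈ Finset.range (2 * k),
          if p.1 = (cs.simple j * cs.simple i) ^ l * cs.simple j then 1 else 0) := by
  induction k with
  | zero => simp; rfl
  | succ k ih =>
    have hi := cs.simple_mul_simple_self i
    have hj := cs.simple_mul_simple_self j
    set a := cs.simple i with ha
    set b := cs.simple j with hb
    have hai : a⁻¹ = a := by simp [ha]
    have hbi : b⁻¹ = b := by simp [hb]
    have hinv : ((a * b) ^ k)⁻¹ = (b * a) ^ k := by
      rw [← inv_pow, mul_inv_rev, hai, hbi]
    have hsw : b * (a * b) ^ k = (b * a) ^ k * b := (mul_pow_mul b a k).symm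
    rw [pow_succ']
    change (signedConj cs i * signedConj cs j) (((signedConj cs i * signedConj cs j) ^ k) p) = _
    rw [ih]
    change signedConj cs i (signedConj cs j _) = _
    simp only [signedConj, ← ha, ← hb]
    have e1 : ((a * b) ^ k * p.1 * ((a * b) ^ k)⁻¹ = b) ↔ p.1 = (b * a) ^ (2 * k) * b := by
      rw [mul_inv_eq_iff_eq_mul, ← eq_inv_mul_iff_mul_eq, hinv, hsw, two_mul, pow_add, mul_assoc]
    have e2 : (b * ((a * b) ^ k * p.1 * ((a * b) ^ k)⁻¹) * b = a) ↔
        p.1 = (b * a) ^ (2 * k + 1) * b := by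
      rw [← eq_mul_inv_iff_mul_eq, hbi, ← eq_inv_mul_iff_mul_eq, hbi, mul_inv_eq_iff_eq_mul,
        ← eq_inv_mul_iff_mul_eq, hinv]
      have : (b * (a * b)) * (a * b) ^ k = (b * a) ^ (k + 1) * b := by
        rw [pow_succ', mul_assoc (b * a), ← hsw]; simp only [mul_assoc]
      rw [this, ← mul_assoc, ← pow_add, two_mul, add_assoc]
    refine Prod.ext ?_ ?_
    · simp only [pow_succ', mul_inv_rev, hai, hbi, mul_assoc]
    · simp only [e1, e2]
      rw [show 2 * (k + 1) = 2 * k + 1 + 1 by ring, Finset.sum_range_succ, Finset.sum_range_succ]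
      ring

lemma isLiftable_signedConj : Mat.IsLiftable (signedConj cs) := by
  intro i j
  funext p
  have h2 : (cs.simple j * cs.simple i) ^ Mat i j = 1 := cs.simple_mul_simple_pow' i j
  rw [signedConj_mul_pow, cs.simple_mul_simple_pow i j, two_mul, Finset.sum_range_add]
  simp only [pow_add, h2, one_mul, inv_one, mul_one]
  rw [← two_mul, show (2 : ZMod 2) = 0 from rfl, zero_mul, add_zero]
  rfl

/-- The action of `W` on `W × ZMod 2` extending `signedConj`. -/
noncomputable def signedConjHom : W →* Function.End (W × ZMod 2) :=
  cs.lift ⟨signedConj cs, isLiftable_signedConj cs⟩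

/-- The reflection cocycle: for a reflection `t` it is `1` exactly when `t` is a right
inversion of `w`. -/
noncomputable def reflSign (w t : W) : ZMod 2 := (signedConjHom cs w (t, 0)).2

lemma signedConjHom_simple (i : B) : signedConjHom cs (cs.simple i) = signedConj cs i :=
  cs.lift_apply_simple (isLiftable_signedConj cs) i

lemma signedConjHom_apply (w : W) : ∀ (t : W) (ε : ZMod 2),
    signedConjHom cs w (t, ε) = (w * t * w⁻¹, ε + reflSign cs w t) := by
  induction w using cs.simple_induction_left with
  | one =>
    intro t ε
    rw [reflSign, map_one]
    change (t, ε) = (1 * t * 1⁻¹, ε + 0)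
    simp
  | mul_simple_left w i ih =>
    have key : ∀ t ε, signedConjHom cs (cs.simple i * w) (t, ε) =
        (cs.simple i * w * t * (cs.simple i * w)⁻¹,
          ε + (reflSign cs w t + if w * t * w⁻¹ = cs.simple i then 1 else 0)) := by
      intro t ε
      rw [map_mul]
      change signedConjHom cs (cs.simple i) (signedConjHom cs w (t, ε)) = _
      rw [ih, signedConjHom_simple]
      simp [signedConj, mul_assoc, add_assoc]
    intro t ε
    have h0 : reflSign cs (cs.simple i * w) t =
        reflSign cs w t + if w * t * w⁻¹ = cs.simple i then 1 else 0 := by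
      conv_lhs => rw [reflSign, key]
      simp
    rw [key, h0]

lemma reflSign_mul (v w t : W) :
    reflSign cs (v * w) t = reflSign cs w t + reflSign cs v (w * t * w⁻¹) := by
  have : signedConjHom cs (v * w) (t, 0) = signedConjHom cs v (signedConjHom cs w (t, 0)) := by
    rw [map_mul]; rfl
  rw [signedConjHom_apply, signedConjHom_apply, signedConjHom_apply] at this
  simpa using (Prod.ext_iff.1 this).2

lemma reflSign_simple (i : B) (t : W) :
    reflSign cs (cs.simple i) t = if t = cs.simple i then 1 else 0 := by
  rw [reflSign, signedConjHom_simple]; simp [signedConj]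

lemma reflSign_one (t : W) : reflSign cs 1 t = 0 := by
  rw [reflSign, map_one]; rfl

lemma reflSign_self {t : W} (ht : cs.IsReflection t) : reflSign cs t t = 1 := by
  obtain ⟨g, i, rfl⟩ := ht
  have h0 := reflSign_mul cs g g⁻¹ (g * cs.simple i * g⁻¹)
  rw [mul_inv_cancel, reflSign_one] at h0
  rw [reflSign_mul, reflSign_mul]
  have e : g⁻¹ * (g * cs.simple i * g⁻¹) * g⁻¹⁻¹ = cs.simple i := by group
  rw [e] at h0 ⊢
  rw [cs.inv_simple, cs.simple_mul_simple_self, one_mul, reflSign_simple, if_pos rfl]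
  calc _ = (reflSign cs g⁻¹ (g * cs.simple i * g⁻¹) + reflSign cs g (cs.simple i)) + 1 := by ring
    _ = 1 := by rw [← h0, zero_add]

lemma mem_rightInvSeq_of_reflSign (ω : List B) (t : W)
    (h : reflSign cs (cs.wordProd ω) t ≠ 0) : t ∈ cs.rightInvSeq ω := by
  induction ω with
  | nil => simp [reflSign_one] at h
  | cons i ω ih =>
    rw [cs.wordProd_cons, reflSign_mul, reflSign_simple] at h
    rw [CoxeterSystem.rightInvSeq, List.mem_cons]
    by_cases h1 : cs.wordProd ω * t * (cs.wordProd ω)⁻¹ = cs.simple i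
    · left; rw [← h1]; group
    · right; exact ih (by simpa [h1] using h)

lemma reflSign_eq_one_iff {t : W} (ht : cs.IsReflection t) (w : W) :
    reflSign cs w t = 1 ↔ cs.length (w * t) < cs.length w := by
  have key : ∀ v, reflSign cs v t ≠ 0 → cs.length (v * t) < cs.length v := by
    intro v hv
    obtain ⟨ω, hω, rfl⟩ := cs.exists_isReduced v
    exact (cs.isRightInversion_of_mem_rightInvSeq hω (mem_rightInvSeq_of_reflSign cs ω t hv)).2
  refine ⟨fun h => key w (by rw [h]; decide), fun h => ?_⟩
  by_contra hne
  have h0 : reflSign cs w t = 0 := by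
    revert hne; generalize reflSign cs w t = a; revert a; decide
  have h1 : reflSign cs (w * t) t ≠ 0 := by
    rw [reflSign_mul, reflSign_self cs ht, mul_inv_cancel_right, h0]; decide
  have := key _ h1
  rw [mul_assoc, ht.mul_self, mul_one] at this
  omega

/-- The strong exchange property. -/
lemma strong_exchange (ω : List B) {t : W} (ht : cs.IsReflection t)
    (h : cs.length (cs.wordProd ω * t) < cs.length (cs.wordProd ω)) :
    ∃ j, cs.wordProd ω * t = cs.wordProd (ω.eraseIdx j) := by
  have h1 := (reflSign_eq_one_iff cs ht _).2 h
  have h2 := mem_rightInvSeq_of_reflSign cs ω t (by rw [h1]; decide)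
  obtain ⟨j, hj, rfl⟩ := List.getElem_of_mem h2
  refine ⟨j, ?_⟩
  rw [← cs.wordProd_mul_getD_rightInvSeq, List.getD_eq_getElem _ _ hj]

lemma length_simple_mul_lt_of_bstep {u t : W} (ht : cs.IsReflection t)
    (h : cs.length u < cs.length (u * t)) (i : B) (hne : u * t ≠ cs.simple i * u) :
    cs.length (cs.simple i * u) < cs.length (cs.simple i * u * t) := by
  have h1 : ¬ reflSign cs u t = 1 := by rw [reflSign_eq_one_iff cs ht]; omega
  have h2 : ¬ reflSign cs (cs.simple i * u) t = 1 := by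
    rw [reflSign_mul, reflSign_simple, if_neg, add_zero]
    · exact h1
    · intro h; apply hne; rw [← h]; group
  rw [reflSign_eq_one_iff cs ht] at h2
  have := ht.length_mul_left_ne (cs.simple i * u)
  omega

end ReflectionCocycle

section BruhatOrder

variable {B : Type*} {W : Type*} [Group W] {Mat : CoxeterMatrix B} (cs : CoxeterSystem Mat W)

lemma ble_refl (u : W) : ble cs u u := Relation.ReflTransGen.refl

variable {cs}

lemma ble.trans {u v w : W} (h : ble cs u v) (h' : ble cs v w) : ble cs u w :=
  Relation.ReflTransGen.trans h h'

lemma ble.length_lt {u v : W} (h : ble cs u v) (hne : u ≠ v) : cs.length u < cs.length v := by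
  have key : u = v ∨ cs.length u < cs.length v := by
    induction h with
    | refl => exact Or.inl rfl
    | tail _ h2 ih => exact Or.inr (by
        rcases eq_or_ne u _ with h | h
        · rw [h]; exact h2.2
        · rcases ih h with rfl | ih
          · exact h2.2
          · exact ih.trans h2.2)
  exact key.resolve_left hne

lemma ble.length_le {u v : W} (h : ble cs u v) : cs.length u ≤ cs.length v := by
  rcases eq_or_ne u v with rfl | hne
  · exact le_rfl
  · exact (h.length_lt hne).le

lemma ble.eq_of_length_le {u v : W} (h : ble cs u v) (hl : cs.length v ≤ cs.length u) :
    u = v := by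
  by_contra hne
  have := h.length_lt hne
  omega

lemma ble.inv {u v : W} (h : ble cs u v) : ble cs u⁻¹ v⁻¹ := by
  induction h with
  | refl => exact ble_refl cs _
  | @tail v w _ h2 ih =>
    refine ih.trans (Relation.ReflTransGen.single ?_)
    obtain ⟨⟨t, ht, rfl⟩, h3⟩ := h2
    refine ⟨⟨v * t * v⁻¹, ht.conj v, ?_⟩, by rwa [cs.length_inv, cs.length_inv]⟩
    rw [mul_inv_rev, ht.inv]; group

variable (cs)

lemma ble_simple_mul_self {i : B} {v : W} (h : cs.length v < cs.length (cs.simple i * v)) :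
    ble cs v (cs.simple i * v) := by
  refine Relation.ReflTransGen.single ⟨⟨v⁻¹ * cs.simple i * v⁻¹⁻¹, ?_, by group⟩, h⟩
  exact (cs.isReflection_simple i).conj v⁻¹

lemma simple_mul_ble_self {i : B} {v : W} (h : cs.length (cs.simple i * v) < cs.length v) :
    ble cs (cs.simple i * v) v := by
  have := ble_simple_mul_self cs (i := i) (v := cs.simple i * v) (by simpa using h)
  simpa using this

lemma mul_simple_ble_self {i : B} {v : W} (h : cs.length (v * cs.simple i) < cs.length v) :
    ble cs (v * cs.simple i) v :=
  Relation.ReflTransGen.single ⟨⟨cs.simple i, cs.isReflection_simple i, by simp⟩, h⟩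

variable {cs}

/-- If `s` is a left descent of `v`, then the lower interval `[e,v]` is stable under left
multiplication by `s`. -/
lemma ble.simple_mul_le {u v : W} {i : B} (h : ble cs u v)
    (hv : cs.length (cs.simple i * v) < cs.length v) : ble cs (cs.simple i * u) v := by
  induction h using Relation.ReflTransGen.head_induction_on with
  | refl => exact simple_mul_ble_self cs hv
  | @head a c h1 h2 ih =>
    obtain ⟨⟨t, ht, rfl⟩, h3⟩ := h1
    by_cases hne : a * t = cs.simple i * a
    · rw [← hne]; exact h2
    · refine ble.trans (Relation.ReflTransGen.single
        ⟨⟨t, ht, rfl⟩, length_simple_mul_lt_of_bstep cs ht h3 i hne⟩) ?_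
      rwa [mul_assoc]

lemma ble.le_simple_mul {u v : W} {i : B} (h : ble cs u v)
    (hu : cs.length u < cs.length (cs.simple i * u)) : ble cs u (cs.simple i * v) := by
  induction h with
  | refl => exact ble_simple_mul_self cs hu
  | @tail b c h1 h2 ih =>
    obtain ⟨⟨t, ht, rfl⟩, h3⟩ := h2
    by_cases hne : b * t = cs.simple i * b
    · rw [hne, cs.simple_mul_simple_cancel_left]; exact h1
    · refine ble.trans ih (Relation.ReflTransGen.single
        ⟨⟨t, ht, by rw [mul_assoc]⟩, ?_⟩)
      have := length_simple_mul_lt_of_bstep cs ht h3 i hne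
      rwa [mul_assoc] at this

lemma length_inv_mul_simple (v : W) (i : B) :
    cs.length (cs.simple i * v⁻¹) = cs.length (v * cs.simple i) := by
  rw [← cs.length_inv (v * cs.simple i), mul_inv_rev, cs.inv_simple]

lemma ble.mul_simple_le {u v : W} {i : B} (h : ble cs u v)
    (hv : cs.length (v * cs.simple i) < cs.length v) : ble cs (u * cs.simple i) v := by
  have := h.inv.simple_mul_le (i := i) (by rwa [length_inv_mul_simple, cs.length_inv])
  simpa using this.inv

lemma ble.le_mul_simple {u v : W} {i : B} (h : ble cs u v)
    (hu : cs.length u < cs.length (u * cs.simple i)) : ble cs u (v * cs.simple i) := by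
  have := h.inv.le_simple_mul (i := i) (by rwa [length_inv_mul_simple, cs.length_inv])
  simpa using this.inv

variable (cs)

lemma one_ble (v : W) : ble cs 1 v := by
  induction hn : cs.length v using Nat.strong_induction_on generalizing v with
  | _ n ih =>
    by_cases hv : v = 1
    · rw [hv]; exact ble_refl cs 1
    · obtain ⟨i, hi⟩ := cs.exists_leftDescent_of_ne_one hv
      exact (ih _ (hn ▸ hi) _ rfl).trans (simple_mul_ble_self cs hi)

variable {cs}

lemma simple_ble_of_left {v : W} {i : B} (hv : cs.length (cs.simple i * v) < cs.length v) :
    ble cs (cs.simple i) v := by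
  simpa using (one_ble cs v).simple_mul_le hv

lemma simple_ble_of_right {v : W} {i : B} (hv : cs.length (v * cs.simple i) < cs.length v) :
    ble cs (cs.simple i) v := by
  simpa using (one_ble cs v).mul_simple_le hv

lemma ble.exists_coatom {u v : W} (h : ble cs u v) (hne : u ≠ v) :
    ∃ z, ble cs u z ∧ ble cs z v ∧ cs.length z + 1 = cs.length v := by
  induction hn : cs.length v using Nat.strong_induction_on generalizing u v with
  | _ n ih =>
    subst hn
    have hlt := h.length_lt hne
    have hv : v ≠ 1 := by rintro rfl; simp at hlt
    obtain ⟨i, hi⟩ := cs.exists_leftDescent_of_ne_one hv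
    have hi' := cs.isLeftDescent_iff.1 hi
    rw [CoxeterSystem.IsLeftDescent] at hi
    rcases cs.length_simple_mul u i with hu | hu
    · exact ⟨_, h.le_simple_mul (by omega), simple_mul_ble_self cs hi, hi'⟩
    · have h1 : ble cs (cs.simple i * u) (cs.simple i * v) :=
        ((simple_mul_ble_self cs (by omega)).trans h).le_simple_mul (by
          rw [cs.simple_mul_simple_cancel_left]; omega)
      obtain ⟨z, hz1, hz2, hz3⟩ := ih _ hi h1 (by simpa using hne) rfl
      have hzv := hz2.trans (simple_mul_ble_self cs hi)
      rcases cs.length_simple_mul z i with hz | hz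
      · refine ⟨cs.simple i * z, ?_, hzv.simple_mul_le hi, by omega⟩
        have : ble cs (cs.simple i * u) (cs.simple i * z) :=
          hz1.trans (ble_simple_mul_self cs (by omega))
        simpa using this.simple_mul_le (i := i) (by
          rw [cs.simple_mul_simple_cancel_left]; omega)
      · refine ⟨cs.simple i * v, ?_, simple_mul_ble_self cs hi, hi'⟩
        have := hz1.simple_mul_le (i := i) (by omega)
        rw [cs.simple_mul_simple_cancel_left] at this
        exact this.trans hz2

lemma bcov_iff {u v : W} : bcov cs u v ↔ ble cs u v ∧ cs.length v = cs.length u + 1 := by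
  constructor
  · rintro ⟨⟨h, hne⟩, h2⟩
    obtain ⟨z, hz1, hz2, hz3⟩ := h.exists_coatom hne
    rcases h2 z hz1 hz2 with rfl | rfl
    · exact ⟨h, hz3.symm⟩
    · omega
  · rintro ⟨h, hl⟩
    refine ⟨⟨h, by rintro rfl; omega⟩, fun z h1 h2 => ?_⟩
    by_contra! hz
    have := h1.length_lt hz.1.symm
    have := h2.length_lt hz.2
    omega

/-- If `s ≠ t` are right descents of `v`, then `s` is a right descent of `v * t`. -/
lemma length_mul_simple_mul_simple_lt {v : W} {i j : B} (hij : cs.simple i ≠ cs.simple j)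
    (hi : cs.length (v * cs.simple i) < cs.length v)
    (hj : cs.length (v * cs.simple j) < cs.length v) :
    cs.length (v * cs.simple j * cs.simple i) < cs.length (v * cs.simple j) := by
  by_contra hlt
  have h1 := (mul_simple_ble_self cs hj).le_mul_simple (i := i) (by
    have := cs.length_mul_simple_ne (v * cs.simple j) i
    omega)
  have h2 := h1.eq_of_length_le (by
    have := cs.isRightDescent_iff.1 hi
    have := cs.isRightDescent_iff.1 hj
    omega)
  exact hij (mul_left_cancel h2).symm

end BruhatOrder

section Parabolic

variable {B : Type*} {W : Type*} [Group W] {Mat : CoxeterMatrix B} (cs : CoxeterSystem Mat W)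

/-- The standard parabolic subgroup `W_J`. -/
def parabolic (J : Set B) : Subgroup W := Subgroup.closure (cs.simple '' J)

variable {cs}

lemma simple_mem_parabolic {J : Set B} {j : B} (hj : j ∈ J) : cs.simple j ∈ parabolic cs J :=
  Subgroup.subset_closure ⟨j, hj, rfl⟩

lemma exists_reduced_word_of_mem_parabolic {J : Set B} {y : W} (hy : y ∈ parabolic cs J) :
    ∃ ω : List B, (∀ i ∈ ω, i ∈ J) ∧ cs.wordProd ω = y ∧ cs.length y = ω.length := by
  have step : ∀ j ∈ J, ∀ z : W,
      (∃ ω : List B, (∀ i ∈ ω, i ∈ J) ∧ cs.wordProd ω = z ∧ cs.length z = ω.length) →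
      ∃ ω : List B, (∀ i ∈ ω, i ∈ J) ∧ cs.wordProd ω = cs.simple j * z ∧
        cs.length (cs.simple j * z) = ω.length := by
    rintro j hj z ⟨ω, hω, rfl, hl⟩
    rcases cs.length_simple_mul (cs.wordProd ω) j with h | h
    · exact ⟨j :: ω, by simpa using ⟨hj, hω⟩, cs.wordProd_cons j ω, by
        rw [h, hl, List.length_cons]⟩
    · have ht := (cs.isReflection_simple j).conj (cs.wordProd ω)⁻¹
      have e : cs.wordProd ω * ((cs.wordProd ω)⁻¹ * cs.simple j * (cs.wordProd ω)⁻¹⁻¹) =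
        cs.simple j * cs.wordProd ω := by group
      obtain ⟨k, hk⟩ := strong_exchange cs ω ht (by rw [e]; omega)
      rw [e] at hk
      refine ⟨ω.eraseIdx k, fun i hi => hω i (List.mem_of_mem_eraseIdx hi), hk.symm, ?_⟩
      have h1 := cs.length_wordProd_le (ω.eraseIdx k)
      rw [← hk] at h1
      have h2 : (ω.eraseIdx k).length = ω.length ∨ (ω.eraseIdx k).length + 1 = ω.length := by
        rw [List.length_eraseIdx]; split <;> omega
      rcases h2 with h2 | h2
      · rw [List.length_eraseIdx] at h2
        split at h2
        · omega
        · rw [List.eraseIdx_of_length_le (by omega)] at hk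
          rw [hk] at h; omega
      · omega
  induction hy using Subgroup.closure_induction_left with
  | one => exact ⟨[], by simp, by simp, by simp⟩
  | mul_left x hx z hz ih =>
    obtain ⟨j, hj, rfl⟩ := hx
    exact step j hj z ih
  | inv_mul_cancel x hx z hz ih =>
    obtain ⟨j, hj, rfl⟩ := hx
    rw [cs.inv_simple]
    exact step j hj z ih

lemma ble.mem_parabolic {J : Set B} {z y : W} (h : ble cs z y) (hy : y ∈ parabolic cs J) :
    z ∈ parabolic cs J := by
  induction h using Relation.ReflTransGen.head_induction_on with
  | refl => exact hy
  | @head a c h1 h2 ih =>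
    obtain ⟨⟨t, ht, rfl⟩, h3⟩ := h1
    obtain ⟨ω, hω, he, -⟩ := exists_reduced_word_of_mem_parabolic ih
    have e : a * t * t = a := by rw [mul_assoc, ht.mul_self, mul_one]
    obtain ⟨k, hk⟩ := strong_exchange cs ω ht (by rw [he, e]; exact h3)
    rw [he, e] at hk
    rw [hk, CoxeterSystem.wordProd]
    refine Subgroup.list_prod_mem _ fun x hx => ?_
    obtain ⟨i, hi, rfl⟩ := List.mem_map.1 hx
    exact simple_mem_parabolic (hω i (List.mem_of_mem_eraseIdx hi))

lemma exists_of_simple_mem_parabolic {J : Set B} {b : B} (h : cs.simple b ∈ parabolic cs J) :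
    ∃ j ∈ J, cs.simple j = cs.simple b := by
  obtain ⟨ω, hω, he, hl⟩ := exists_reduced_word_of_mem_parabolic h
  rw [cs.length_simple] at hl
  obtain ⟨j, rfl⟩ := List.length_eq_one_iff.1 hl.symm
  exact ⟨j, hω j (by simp), by simpa using he⟩

lemma mul_mem_WH_of_left_descent {J : Set B} {x : W} {r : B} (hx : x ∈ WH cs J)
    (hr : cs.length (cs.simple r * x) < cs.length x) : cs.simple r * x ∈ WH cs J := by
  intro j hj
  have h1 := hx j hj
  have h2 := cs.length_simple_mul (x * cs.simple j) r
  rw [← mul_assoc] at h2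
  have h3 := cs.length_mul_simple_ne (cs.simple r * x) j
  omega

/-- Deodhar's lemma. -/
lemma simple_mul_mem_WH_or {J : Set B} {x : W} (r : B) (hx : x ∈ WH cs J) :
    cs.simple r * x ∈ WH cs J ∨ ∃ j ∈ J, cs.simple r * x = x * cs.simple j := by
  by_contra! hcon
  obtain ⟨h1, h2⟩ := hcon
  apply h1
  intro j hj
  exact length_simple_mul_lt_of_bstep cs (cs.isReflection_simple j) (hx j hj) r (h2 j hj).symm

lemma length_mul_of_forall_le {J : Set B} {x : W}
    (hx : ∀ y ∈ parabolic cs J, cs.length x ≤ cs.length (x * y)) :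
    ∀ y ∈ parabolic cs J, cs.length (x * y) = cs.length x + cs.length y := by
  intro y hy
  induction hn : cs.length y using Nat.strong_induction_on generalizing y with
  | _ n ih =>
    subst hn
    by_cases h1 : y = 1
    · simp [h1]
    obtain ⟨i, hi⟩ := cs.exists_rightDescent_of_ne_one h1
    have hi' := cs.isRightDescent_iff.1 hi
    rw [CoxeterSystem.IsRightDescent] at hi
    have hs : cs.simple i ∈ parabolic cs J := (simple_ble_of_right hi).mem_parabolic hy
    have hy' := mul_mem hy hs
    have e := ih _ hi _ hy' rfl
    have e2 : x * (y * cs.simple i) * cs.simple i = x * y := by simp [mul_assoc]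
    have e3 := cs.length_mul_simple (x * (y * cs.simple i)) i
    rw [e2] at e3
    rcases e3 with e3 | e3
    · omega
    exfalso
    have ht := cs.isReflection_simple i
    have s1 := (reflSign_eq_one_iff cs ht (x * (y * cs.simple i))).2 (by rw [e2]; omega)
    have s2 : ¬ reflSign cs (y * cs.simple i) (cs.simple i) = 1 := by
      rw [reflSign_eq_one_iff cs ht]; simp; omega
    rw [reflSign_mul] at s1
    have s3 : reflSign cs x (y * cs.simple i * cs.simple i * (y * cs.simple i)⁻¹) = 1 := by
      revert s1 s2
      generalize reflSign cs (y * cs.simple i) (cs.simple i) = a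
      generalize reflSign cs x _ = b
      revert a b; decide
    rw [reflSign_eq_one_iff cs (ht.conj _)] at s3
    have := hx (y * cs.simple i * cs.simple i * (y * cs.simple i)⁻¹)
      (mul_mem (mul_mem hy' hs) (inv_mem hy'))
    omega

lemma exists_mul_of_parabolic (J : Set B) (u : W) :
    ∃ x y, x ∈ WH cs J ∧ y ∈ parabolic cs J ∧ u = x * y ∧
      ∀ z ∈ parabolic cs J, cs.length (x * z) = cs.length x + cs.length z := by
  obtain ⟨⟨y, hy⟩, -, hmin⟩ := (measure fun y : parabolic cs J => cs.length (u * y)).wf.has_min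
    Set.univ ⟨1, trivial⟩
  have hadd := length_mul_of_forall_le (cs := cs) (J := J) (x := u * y) (fun z hz => by
    have : ¬ cs.length (u * (y * z)) < cs.length (u * y) := hmin ⟨y * z, mul_mem hy hz⟩ trivial
    rw [mul_assoc]; omega)
  refine ⟨u * y, y⁻¹, fun j hj => ?_, inv_mem hy, by group, hadd⟩
  rw [hadd _ (simple_mem_parabolic hj), cs.length_simple]; omega

lemma length_mul_of_mem_WH {J : Set B} {x y : W} (hx : x ∈ WH cs J) (hy : y ∈ parabolic cs J) :
    cs.length (x * y) = cs.length x + cs.length y := by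
  obtain ⟨x0, y0, -, hy0, rfl, hadd⟩ := exists_mul_of_parabolic (cs := cs) J x
  by_cases h1 : y0 = 1
  · subst h1; simpa using hadd y hy
  exfalso
  obtain ⟨i, hi⟩ := cs.exists_rightDescent_of_ne_one h1
  rw [CoxeterSystem.IsRightDescent] at hi
  obtain ⟨j, hj, hji⟩ := exists_of_simple_mem_parabolic ((simple_ble_of_right hi).mem_parabolic hy0)
  have h2 := hx j hj
  rw [hji, mul_assoc, hadd _ hy0, hadd _ (mul_mem hy0 (hji ▸ simple_mem_parabolic hj))] at h2
  omega

lemma length_mul_of_inv_mem_WH {K : Set B} {x y : W} (hx : x ∈ parabolic cs K)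
    (hy : y⁻¹ ∈ WH cs K) : cs.length (x * y) = cs.length x + cs.length y := by
  have := length_mul_of_mem_WH hy (inv_mem hx)
  rw [← mul_inv_rev, cs.length_inv, cs.length_inv, cs.length_inv] at this
  omega

lemma ble_mul_of_mem_WH {J : Set B} {x y : W} (hx : x ∈ WH cs J) (hy : y ∈ parabolic cs J) :
    ble cs x (x * y) := by
  induction hn : cs.length y using Nat.strong_induction_on generalizing y with
  | _ n ih =>
    subst hn
    by_cases h1 : y = 1
    · rw [h1, mul_one]; exact ble_refl cs x
    obtain ⟨i, hi⟩ := cs.exists_rightDescent_of_ne_one h1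
    rw [CoxeterSystem.IsRightDescent] at hi
    have hy' := mul_mem hy ((simple_ble_of_right hi).mem_parabolic hy)
    refine (ih _ hi hy' rfl).trans ?_
    rw [← mul_assoc]
    apply mul_simple_ble_self
    rw [mul_assoc, length_mul_of_mem_WH hx hy, length_mul_of_mem_WH hx hy']
    omega

/-- If `u = x * y` with `x ∈ W_K`, `y ∈ W_J`, then `x` can be chosen in `W^J`. -/
lemma exists_factor_left_min {J K : Set B} {x y : W} (hx : x ∈ parabolic cs K)
    (hy : y ∈ parabolic cs J) : ∃ x' y', x' ∈ parabolic cs K ∧ x' ∈ WH cs J ∧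
      y' ∈ parabolic cs J ∧ x * y = x' * y' := by
  obtain ⟨x', z, hx', hz, rfl, -⟩ := exists_mul_of_parabolic (cs := cs) J x
  exact ⟨x', z * y, (ble_mul_of_mem_WH hx' hz).mem_parabolic hx, hx', mul_mem hz hy,
    mul_assoc _ _ _⟩

lemma exists_factor_right_min {J K : Set B} {x y : W} (hx : x ∈ parabolic cs K)
    (hy : y ∈ parabolic cs J) : ∃ x' y', x' ∈ parabolic cs K ∧ y' ∈ parabolic cs J ∧
      y'⁻¹ ∈ WH cs K ∧ x * y = x' * y' := by
  obtain ⟨a, b, ha, ha', hb, hab⟩ := exists_factor_left_min (inv_mem hy) (inv_mem hx)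
  refine ⟨b⁻¹, a⁻¹, inv_mem hb, inv_mem ha, by simpa using ha', ?_⟩
  rw [← mul_inv_rev, ← hab, mul_inv_rev, inv_inv, inv_inv]

/-- A right descent `b ∉ J` of `x * y`, where `x ∈ W_K` and `y ∈ W_J` is a minimal left coset
representative, commutes with `y`. -/
lemma mul_simple_comm_of_right_descent {J K : Set B} {x y : W} {b : B}
    (hx : x ∈ parabolic cs K) (hy : y ∈ parabolic cs J) (hy' : y⁻¹ ∈ WH cs K)
    (hb : cs.simple b ∉ parabolic cs J)
    (hd : cs.length (x * y * cs.simple b) < cs.length (x * y)) :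
    y * cs.simple b = cs.simple b * y := by
  rcases simple_mul_mem_WH_or (cs := cs) b hy' with h | ⟨k, hk, h⟩
  · exfalso
    have h1 : (y * cs.simple b)⁻¹ ∈ WH cs K := by rwa [mul_inv_rev, cs.inv_simple]
    have h2 := length_mul_of_inv_mem_WH hx h1
    have h3 := length_mul_of_inv_mem_WH hx hy'
    rw [mul_assoc, h2, h3] at hd
    exact hb ((simple_ble_of_right (by omega)).mem_parabolic hy)
  · have h1 : y * cs.simple b = cs.simple k * y := by
      have := congrArg (·⁻¹) h
      simpa using this
    have h2 : cs.simple k ∈ parabolic cs (insert b J) := by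
      have hJ : parabolic cs J ≤ parabolic cs (insert b J) :=
        Subgroup.closure_mono (Set.image_mono (Set.subset_insert b J))
      have : cs.simple k = y * cs.simple b * y⁻¹ := by rw [h1]; group
      rw [this]
      exact mul_mem (mul_mem (hJ hy) (simple_mem_parabolic (Set.mem_insert b J)))
        (inv_mem (hJ hy))
    obtain ⟨j, hj, hjk⟩ := exists_of_simple_mem_parabolic h2
    rcases hj with rfl | hj
    · rw [h1, hjk]
    · exfalso
      apply hb
      have : cs.simple b = y⁻¹ * cs.simple k * y := by rw [mul_assoc, ← h1]; group
      rw [this, ← hjk]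
      exact mul_mem (mul_mem (inv_mem hy) (simple_mem_parabolic hj)) hy

end Parabolic

section Factorization

variable {B : Type*} {W : Type*} [Group W] {Mat : CoxeterMatrix B} (cs : CoxeterSystem Mat W)

/-- The value at `z` of the matching `M` is given by inserting `s` in the middle of a
factorization of `z` in `W_K * W_J`. -/
def InsertsAt (M : W → W) (s : B) (J K : Set B) (z : W) : Prop :=
  ∃ x ∈ parabolic cs K, ∃ y ∈ parabolic cs J, z = x * y ∧ M z = x * cs.simple s * y

/-- The situation of a minimal pair `u = M w`, `w` at which a special matching `M` of `[e,w]`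
would fail to be given by insertion of `s`. -/
structure InsertionFailure (M : W → W) (w u : W) (s : B) (J K : Set B) : Prop where
  stable : ∀ z, ble cs z w → ble cs (M z) w
  invol : ∀ z, ble cs z w → M (M z) = z
  length_apply : ∀ z, ble cs z w →
    cs.length z = cs.length (M z) + 1 ∨ cs.length (M z) = cs.length z + 1
  apply_top : M w = u
  length_top : cs.length w = cs.length u + 1
  apply_one : M 1 = cs.simple s
  memJ : s ∈ J
  memK : s ∈ K
  comm : ∀ i ∈ J, i ∈ K → cs.simple i * cs.simple s = cs.simple s * cs.simple i
  cover : ∀ i, ble cs (cs.simple i) w → i ∈ J ∨ i ∈ K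
  satJ : ∀ i j, cs.simple i = cs.simple j → i ∈ J → j ∈ J
  satK : ∀ i j, cs.simple i = cs.simple j → i ∈ K → j ∈ K
  apply_simple_of_notMem_J : ∀ b, ble cs (cs.simple b) w → b ∉ J →
    M (cs.simple b) = cs.simple b * cs.simple s
  apply_simple_of_notMem_K : ∀ a, ble cs (cs.simple a) w → a ∉ K →
    M (cs.simple a) = cs.simple s * cs.simple a
  noncomm_of_notMem_J : ∀ b ∈ K, b ∉ J → cs.simple b * cs.simple s ≠ cs.simple s * cs.simple b
  noncomm_of_notMem_K : ∀ a ∈ J, a ∉ K → cs.simple a * cs.simple s ≠ cs.simple s * cs.simple a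
  braid : ∀ b, cs.simple b * cs.simple s ≠ cs.simple s * cs.simple b →
    cs.simple b * cs.simple s * cs.simple b = cs.simple s * cs.simple b * cs.simple s
  inserts : ∀ z, ble cs z w → z ≠ w → z ≠ u → InsertsAt cs M s J K z
  not_inserts : ¬ InsertsAt cs M s J K u

variable {cs}

/-- Elements of `W_K ∩ W_J` commute with `s` if the generators in `J ∩ K` do. -/
lemma commute_of_mem_parabolic_inter {s : B} {J K : Set B}
    (comm : ∀ i ∈ J, i ∈ K → cs.simple i * cs.simple s = cs.simple s * cs.simple i)
    (satJ : ∀ i j, cs.simple i = cs.simple j → i ∈ J → j ∈ J)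
    (satK : ∀ i j, cs.simple i = cs.simple j → i ∈ K → j ∈ K)
    {g : W} (hJ : g ∈ parabolic cs J) (hK : g ∈ parabolic cs K) :
    g * cs.simple s = cs.simple s * g := by
  induction hn : cs.length g using Nat.strong_induction_on generalizing g with
  | _ n ih =>
    subst hn
    by_cases h1 : g = 1
    · simp [h1]
    obtain ⟨i, hi⟩ := cs.exists_rightDescent_of_ne_one h1
    rw [CoxeterSystem.IsRightDescent] at hi
    have mJ := (simple_ble_of_right hi).mem_parabolic hJ
    have mK := (simple_ble_of_right hi).mem_parabolic hK
    have e := ih _ hi (mul_mem hJ mJ) (mul_mem hK mK) rfl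
    obtain ⟨j, hj, hji⟩ := exists_of_simple_mem_parabolic mJ
    obtain ⟨k, hk, hki⟩ := exists_of_simple_mem_parabolic mK
    have c := comm i (satJ j i hji hj) (satK k i hki hk)
    calc g * cs.simple s = g * cs.simple i * (cs.simple i * cs.simple s) := by simp [mul_assoc]
      _ = g * cs.simple i * cs.simple s * cs.simple i := by rw [c, mul_assoc, mul_assoc, mul_assoc]
      _ = cs.simple s * g := by rw [e]; simp [mul_assoc]

/-- The value of `M` at `x * y` does not depend on the chosen factorization. -/
lemma InsertsAt.apply_mul {M : W → W} {s : B} {J K : Set B}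
    (comm : ∀ i ∈ J, i ∈ K → cs.simple i * cs.simple s = cs.simple s * cs.simple i)
    (satJ : ∀ i j, cs.simple i = cs.simple j → i ∈ J → j ∈ J)
    (satK : ∀ i j, cs.simple i = cs.simple j → i ∈ K → j ∈ K)
    {x y : W} (h : InsertsAt cs M s J K (x * y)) (hx : x ∈ parabolic cs K)
    (hy : y ∈ parabolic cs J) : M (x * y) = x * cs.simple s * y := by
  obtain ⟨x', hx', y', hy', e, e'⟩ := h
  rw [e']
  have e2 : x⁻¹ * x' = y * y'⁻¹ := by
    rw [inv_mul_eq_iff_eq_mul, ← mul_assoc, e]; group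
  have c := commute_of_mem_parabolic_inter comm satJ satK (g := x⁻¹ * x')
    (e2 ▸ mul_mem hy (inv_mem hy')) (mul_mem (inv_mem hx) hx')
  calc x' * cs.simple s * y' = x * (x⁻¹ * x' * cs.simple s) * y' := by group
    _ = x * cs.simple s * (x⁻¹ * x') * y' := by rw [c]; group
    _ = x * cs.simple s * y := by rw [e2]; group

namespace InsertionFailure

variable {M : W → W} {w u : W} {s : B} {J K : Set B}

lemma symm (h : InsertionFailure cs M w u s J K) :
    InsertionFailure cs (fun z => (M z⁻¹)⁻¹) w⁻¹ u⁻¹ s K J := by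
  have hle : ∀ z, ble cs z w⁻¹ → ble cs z⁻¹ w := fun z hz => by simpa using hz.inv
  have hins : ∀ z, InsertsAt cs (fun z => (M z⁻¹)⁻¹) s K J z ↔ InsertsAt cs M s J K z⁻¹ := by
    intro z
    constructor
    · rintro ⟨x, hx, y, hy, e, e'⟩
      refine ⟨y⁻¹, inv_mem hy, x⁻¹, inv_mem hx, by rw [e, mul_inv_rev], ?_⟩
      have e2 : (M z⁻¹)⁻¹ = x * cs.simple s * y := e'
      rw [← inv_inj, e2]; simp [mul_assoc]
    · rintro ⟨x, hx, y, hy, e, e'⟩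
      refine ⟨y⁻¹, inv_mem hy, x⁻¹, inv_mem hx, by rw [← mul_inv_rev, ← e, inv_inv], ?_⟩
      rw [← inv_inj, inv_inv, e']; simp [mul_assoc]
  have hs : ∀ b, ble cs (cs.simple b) w⁻¹ → ble cs (cs.simple b) w := fun b hb => by
    simpa using hle _ hb
  constructor
  · exact fun z hz => (h.stable _ (hle z hz)).inv
  · intro z hz
    simp [h.invol _ (hle z hz)]
  · intro z hz
    have := h.length_apply _ (hle z hz)
    simpa using this
  · simp [h.apply_top]
  · simpa using h.length_top
  · simp [h.apply_one]
  · exact h.memK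
  · exact h.memJ
  · exact fun i h1 h2 => h.comm i h2 h1
  · exact fun i hi => (h.cover i (hs i hi)).symm
  · exact h.satK
  · exact h.satJ
  · intro b hb hbK
    simp [h.apply_simple_of_notMem_K b (hs b hb) hbK]
  · intro b hb hbJ
    simp [h.apply_simple_of_notMem_J b (hs b hb) hbJ]
  · exact h.noncomm_of_notMem_K
  · exact h.noncomm_of_notMem_J
  · exact h.braid
  · intro z hz h1 h2
    exact (hins z).2 (h.inserts _ (hle z hz) (fun e => h1 (by rw [← e, inv_inv]))
      (fun e => h2 (by rw [← e, inv_inv])))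
  · rw [hins, inv_inv]; exact h.not_inserts

variable (h : InsertionFailure cs M w u s J K)
include h

lemma apply_mul {x y : W} (hx : x ∈ parabolic cs K) (hy : y ∈ parabolic cs J)
    (hle : ble cs (x * y) w) (hw : x * y ≠ w) (hu : x * y ≠ u) :
    M (x * y) = x * cs.simple s * y :=
  (h.inserts _ hle hw hu).apply_mul h.comm h.satJ h.satK hx hy

lemma apply_bot : M u = w := by
  rw [← h.apply_top, h.invol w (ble_refl cs w)]

lemma length_coatom {d : W} (hd : ble cs d w) (hl : cs.length d + 1 = cs.length w)
    (hu : d ≠ u) : cs.length (M d) + 2 = cs.length w := by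
  rcases h.length_apply d hd with h1 | h1
  · omega
  · exfalso
    have e := (h.stable d hd).eq_of_length_le (by omega)
    apply hu
    rw [← h.invol d hd, e, h.apply_top]

lemma ne_of_length {d : W} (hl : cs.length d + 2 ≤ cs.length w) : d ≠ w ∧ d ≠ u := by
  have := h.length_top
  constructor <;> (rintro rfl; omega)

lemma simple_mul_eq {r : B} (hr : r ∈ K) (hd : cs.length (cs.simple r * w) < cs.length w) :
    cs.simple r * w = u := by
  by_contra hne
  have hl := cs.isLeftDescent_iff.1 hd
  have hle := simple_mul_ble_self cs hd
  have hdw : cs.simple r * w ≠ w := fun e => by rw [e] at hd; omega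
  obtain ⟨x, hx, y, hy, e, e'⟩ := h.inserts _ hle hdw hne
  have hf := h.length_coatom hle hl hne
  have hf' := h.stable _ hle
  have hrf := hf'.simple_mul_le hd
  have hlen := cs.length_simple_mul (M (cs.simple r * w)) r
  have ew : w = cs.simple r * x * y := by rw [mul_assoc, ← e]; simp
  have e2 : cs.simple r * M (cs.simple r * w) = cs.simple r * x * cs.simple s * y := by
    rw [e']; simp only [mul_assoc]
  have hx2 : cs.simple r * x * cs.simple s ∈ parabolic cs K :=
    mul_mem (mul_mem (simple_mem_parabolic hr) hx) (simple_mem_parabolic h.memK)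
  by_cases hru : cs.simple r * M (cs.simple r * w) = u
  · refine h.not_inserts ⟨_, hx2, y, hy, by rw [← e2, hru], ?_⟩
    rw [h.apply_bot, cs.simple_mul_simple_cancel_right, ew]
  · have hrw : cs.simple r * M (cs.simple r * w) ≠ w := fun e => by rw [e] at hlen; omega
    rw [e2] at hrf hru hrw
    have := h.apply_mul hx2 hy hrf hrw hru
    rw [cs.simple_mul_simple_cancel_right, ← ew] at this
    apply hru
    rw [← h.invol _ hrf, this, h.apply_top]

lemma mul_simple_eq {r : B} (hr : r ∈ J) (hd : cs.length (w * cs.simple r) < cs.length w) :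
    w * cs.simple r = u := by
  have := h.symm.simple_mul_eq hr (by rwa [length_inv_mul_simple, cs.length_inv])
  rw [← inv_inj, ← this]; simp

lemma simple_mem_parabolic_iff_J {b : B} : cs.simple b ∈ parabolic cs J ↔ b ∈ J := by
  refine ⟨fun hb => ?_, simple_mem_parabolic⟩
  obtain ⟨j, hj, e⟩ := exists_of_simple_mem_parabolic hb
  exact h.satJ _ _ e hj

lemma simple_mem_parabolic_iff_K {b : B} : cs.simple b ∈ parabolic cs K ↔ b ∈ K :=
  h.symm.simple_mem_parabolic_iff_J

lemma mul_simple_eq_of_lt {b : B} (hd : cs.length (w * cs.simple b) < cs.length w) :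
    w * cs.simple b = u := by
  by_contra hne
  have hbJ : b ∉ J := fun hb => hne (h.mul_simple_eq hb hd)
  have hbw := simple_ble_of_right hd
  have hbK : b ∈ K := (h.cover b hbw).resolve_left hbJ
  have hbJ' : cs.simple b ∉ parabolic cs J := by rwa [h.simple_mem_parabolic_iff_J]
  have hsJ : cs.simple s ∈ parabolic cs J := simple_mem_parabolic h.memJ
  have hsK : cs.simple s ∈ parabolic cs K := simple_mem_parabolic h.memK
  have hbK' : cs.simple b ∈ parabolic cs K := simple_mem_parabolic hbK
  have hnc := h.noncomm_of_notMem_J b hbK hbJ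
  have hbr := h.braid b hnc
  have hbs : cs.simple b ≠ cs.simple s := fun e => hnc (by rw [e])
  have hlu := h.length_top
  have hlc := cs.isRightDescent_iff.1 hd
  have hcw := mul_simple_ble_self cs hd
  have hcne : w * cs.simple b ≠ w := fun e => by rw [e] at hd; omega
  have hlh := h.length_coatom hcw hlc hne
  have hhw := h.stable _ hcw
  have hMh := h.invol _ hcw
  obtain ⟨x0, hx0, y0, hy0, e0, -⟩ := h.inserts _ hcw hcne hne
  obtain ⟨x1, y, hx1, hx1J, hy, e1⟩ := exists_factor_left_min hx0 hy0
  rw [e1] at e0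
  have hMc := h.apply_mul hx1 hy (e0 ▸ hcw) (e0 ▸ hcne) (e0 ▸ hne)
  rw [← e0] at hMc
  clear e1 hx0 hy0 x0 y0
  by_cases hx1' : x1 = 1
  · have h1 := h.stable _ hbw
    rw [h.apply_simple_of_notMem_J b hbw hbJ] at h1
    have h2 := h1.le_mul_simple (i := b) (by
      by_contra hlt
      have h3 : cs.length (cs.simple b * cs.simple s * cs.simple b) <
          cs.length (cs.simple b * cs.simple s) := by
        have := cs.length_mul_simple_ne (cs.simple b * cs.simple s) b
        omega
      have h4 : cs.length (cs.simple b * cs.simple s * cs.simple s) <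
          cs.length (cs.simple b * cs.simple s) := by
        rw [cs.simple_mul_simple_cancel_right, cs.length_simple]
        by_contra h5
        have h6 := cs.length_mul_simple (cs.simple b) s
        rw [cs.length_simple] at h6
        have h7 : cs.length (cs.simple b * cs.simple s) = 0 := by omega
        rw [cs.length_eq_zero_iff, mul_eq_one_iff_eq_inv, cs.inv_simple] at h7
        exact hbs h7
      have h5 := length_mul_simple_mul_simple_lt hbs.symm h4 h3
      rw [hbr, cs.simple_mul_simple_cancel_right] at h5
      have h6 := cs.length_mul_le (cs.simple b) (cs.simple s)
      rw [cs.length_simple, cs.length_simple] at h6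
      rw [hbr] at h3
      have h7 : cs.length (cs.simple s * cs.simple b) = 0 := by omega
      rw [cs.length_eq_zero_iff, mul_eq_one_iff_eq_inv, cs.inv_simple] at h7
      exact hbs h7.symm)
    rw [e0, hx1', one_mul] at h2
    have h3 := mul_mem (h2.mem_parabolic hy) hsJ
    rw [cs.simple_mul_simple_cancel_right] at h3
    exact hbJ' h3
  obtain ⟨r, hr⟩ := cs.exists_leftDescent_of_ne_one hx1'
  have hr' := cs.isLeftDescent_iff.1 hr
  rw [CoxeterSystem.IsLeftDescent] at hr
  have hrK : r ∈ K := h.simple_mem_parabolic_iff_K.1 ((simple_ble_of_left hr).mem_parabolic hx1)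
  have hrx1 := mul_mem_WH_of_left_descent hx1J hr
  have hlx1 : ∀ z ∈ parabolic cs J, cs.length (cs.simple r * x1 * z) + 1 =
      cs.length (x1 * z) := fun z hz => by
    rw [length_mul_of_mem_WH hrx1 hz, length_mul_of_mem_WH hx1J hz]; omega
  have ew : w = x1 * y * cs.simple b := by rw [← e0, cs.simple_mul_simple_cancel_right]
  have hru : cs.simple r * w = u := h.simple_mul_eq hrK (by
    have h1 := hlx1 y hy
    have h2 := cs.length_mul_simple (cs.simple r * x1 * y) b
    rw [← e0] at h1
    have h3 : cs.simple r * w = cs.simple r * x1 * y * cs.simple b := by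
      rw [ew]; simp only [mul_assoc]
    rw [h3]; omega)
  have hhb : M (w * cs.simple b) * cs.simple b ≠ u := by
    rw [← hru, hMc, ew]
    intro e
    have e2 : x1 * cs.simple s = cs.simple r * x1 := by
      simpa [← mul_assoc] using e
    have h1 := hx1J s h.memJ
    rw [e2] at h1
    omega
  generalize hh : M (w * cs.simple b) = z at *
  have hz := h.ne_of_length (d := z) (by omega)
  rcases cs.length_mul_simple z b with hzb | hzb
  · have hgw := hhw.mul_simple_le hd
    have hgne : z * cs.simple b ≠ w := fun e => by rw [e] at hzb; omega
    obtain ⟨x, hx, y', hy', e2, -⟩ := h.inserts _ hgw hgne hhb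
    obtain ⟨x5, y5, hx5, hy5, hy5K, e3⟩ := exists_factor_right_min hx hy'
    rw [e3] at e2
    have hMg := h.apply_mul hx5 hy5 (e2 ▸ hgw) (e2 ▸ hgne) (e2 ▸ hhb)
    have hlg := h.length_coatom hgw (by omega) hhb
    have ez : z = x5 * y5 * cs.simple b := by rw [← e2, cs.simple_mul_simple_cancel_right]
    have hcomm := mul_simple_comm_of_right_descent hx5 hy5 hy5K hbJ' (by
      rw [← ez, ← e2]; omega)
    have ez' : z = x5 * cs.simple b * y5 := by rw [ez, mul_assoc, hcomm, mul_assoc]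
    have hx5b := mul_mem hx5 hbK'
    have hMz := h.apply_mul hx5b hy5 (ez' ▸ hhw) (ez' ▸ hz.1) (ez' ▸ hz.2)
    have l1 := length_mul_of_inv_mem_WH hx5 hy5K
    have l2 := length_mul_of_inv_mem_WH (mul_mem hx5 hsK) hy5K
    have l3 := length_mul_of_inv_mem_WH hx5b hy5K
    have l4 := length_mul_of_inv_mem_WH (mul_mem hx5b hsK) hy5K
    rw [← ez'] at l3
    rw [← e2] at l1
    rw [← hMg, ← e2] at l2
    rw [← hMz, ← ez', hMh] at l4
    have := length_mul_simple_mul_simple_lt hbs.symm (v := x5) (i := s) (j := b)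
      (by omega) (by omega)
    omega
  · obtain ⟨x, hx, y', hy', e2, -⟩ := h.inserts _ hhw hz.1 hz.2
    obtain ⟨x4, y3, hx4, hy3, hy3K, e3⟩ := exists_factor_right_min hx hy'
    rw [e3] at e2
    have hMz := h.apply_mul hx4 hy3 (e2 ▸ hhw) (e2 ▸ hz.1) (e2 ▸ hz.2)
    rw [← e2, hMh] at hMz
    have hcomm := mul_simple_comm_of_right_descent hx4 hy3 hy3K hbJ' (by
      rw [← e2]; omega)
    have ew2 : w = x4 * cs.simple s * cs.simple b * y3 := by
      have : w = x4 * cs.simple s * y3 * cs.simple b := by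
        rw [← hMz, cs.simple_mul_simple_cancel_right]
      rw [this, mul_assoc, hcomm, mul_assoc, mul_assoc, mul_assoc]
    have l1 := length_mul_of_inv_mem_WH (mul_mem (mul_mem hx4 hsK) hbK') hy3K
    have l2 := length_mul_of_inv_mem_WH (mul_mem hx4 hsK) hy3K
    have l3 := length_mul_of_inv_mem_WH hx4 hy3K
    rw [← ew2] at l1
    rw [← hMz] at l2
    rw [← e2] at l3
    by_cases hy31 : y3 = 1
    · rw [hy31, mul_one] at e2 ew2
      have ew3 : w * cs.simple s = x4 * cs.simple b * cs.simple s * cs.simple b := by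
        have h1 : w = x4 * cs.simple b * (cs.simple b * cs.simple s * cs.simple b) := by
          rw [ew2]; simp [mul_assoc]
        rw [h1, hbr]; simp [mul_assoc]
      have h1 := cs.length_mul_simple (x4 * cs.simple b) s
      have h2 := cs.length_mul_simple (x4 * cs.simple b * cs.simple s) b
      rw [e2] at hzb hlh
      have hws := h.mul_simple_eq h.memJ (by rw [ew3]; omega)
      have hu1 : u ≠ 1 := by
        rintro rfl
        rw [cs.length_one] at hlu; omega
      obtain ⟨p, hp⟩ := cs.exists_leftDescent_of_ne_one hu1
      have hp' := cs.isLeftDescent_iff.1 hp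
      have ep : cs.simple p * w = cs.simple p * u * cs.simple s := by
        rw [← hws]; simp [mul_assoc]
      have h3 := cs.length_mul_simple (cs.simple p * u) s
      have hpw : cs.length (cs.simple p * w) < cs.length w := by rw [ep]; omega
      have hwK : w ∈ parabolic cs K := by
        rw [ew2]; exact mul_mem (mul_mem hx4 hsK) hbK'
      have hpu := h.simple_mul_eq
        (h.simple_mem_parabolic_iff_K.1 ((simple_ble_of_left hpw).mem_parabolic hwK)) hpw
      rw [← hpu, cs.simple_mul_simple_cancel_left, hpu] at hp'
      omega
    · obtain ⟨q, hq⟩ := cs.exists_rightDescent_of_ne_one hy31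
      have hq' := cs.isRightDescent_iff.1 hq
      rw [CoxeterSystem.IsRightDescent] at hq
      have hqJ : q ∈ J :=
        h.simple_mem_parabolic_iff_J.1 ((simple_ble_of_right hq).mem_parabolic hy3)
      have h1 := cs.length_mul_le (x4 * cs.simple s * cs.simple b) (y3 * cs.simple q)
      rw [← mul_assoc, ← ew2] at h1
      have hwq := h.mul_simple_eq hqJ (by omega)
      have h2 : w = cs.simple r * (x4 * cs.simple s) * cs.simple b * (y3 * cs.simple q) := by
        have : w = cs.simple r * (w * cs.simple q) := by rw [hwq, ← hru]; simp
        rw [this, ew2]; simp only [mul_assoc]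
      have h3 := hlx1 (y * y3⁻¹) (mul_mem hy (inv_mem hy3))
      have h4 : x1 * (y * y3⁻¹) = x4 * cs.simple s := by
        rw [← mul_assoc, ← e0, hMz]; group
      rw [mul_assoc, h4] at h3
      have h5 := cs.length_mul_le (cs.simple r * (x4 * cs.simple s) * cs.simple b)
        (y3 * cs.simple q)
      rw [← h2] at h5
      have h6 := cs.length_mul_simple (cs.simple r * (x4 * cs.simple s)) b
      omega

lemma simple_mul_eq_of_lt {b : B} (hd : cs.length (cs.simple b * w) < cs.length w) :
    cs.simple b * w = u := by
  have := h.symm.mul_simple_eq_of_lt (b := b) (by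
    rw [← length_inv_mul_simple, inv_inv, cs.length_inv]; exact hd)
  rw [← inv_inj, ← this]; simp

lemma elim : False := by
  have hl := h.length_top
  have hw : w ≠ 1 := by
    rintro rfl
    rw [cs.length_one] at hl; omega
  obtain ⟨r, hr⟩ := cs.exists_leftDescent_of_ne_one hw
  obtain ⟨q, hq⟩ := cs.exists_rightDescent_of_ne_one hw
  have hru := h.simple_mul_eq_of_lt hr
  have hqu := h.mul_simple_eq_of_lt hq
  by_cases hu : u = 1
  · subst hu
    exact h.not_inserts ⟨1, one_mem _, 1, one_mem _, by simp, by simp [h.apply_one]⟩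
  · obtain ⟨p, hp⟩ := cs.exists_leftDescent_of_ne_one hu
    have hp' := cs.isLeftDescent_iff.1 hp
    have ep : cs.simple p * w = cs.simple p * u * cs.simple q := by
      rw [← hqu]; simp [mul_assoc]
    have h3 := cs.length_mul_simple (cs.simple p * u) q
    have hpu := h.simple_mul_eq_of_lt (b := p) (by rw [ep]; omega)
    rw [← hpu, cs.simple_mul_simple_cancel_left, hpu] at hp'
    omega

end InsertionFailure

end Factorization

section SpecialMatchings

variable {B : Type*} {W : Type*} [Group W] {Mat : CoxeterMatrix B} {cs : CoxeterSystem Mat W}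

lemma ble.exists_atom {u v : W} (h : ble cs u v) (hne : u ≠ v) :
    ∃ z, ble cs u z ∧ ble cs z v ∧ cs.length z = cs.length u + 1 := by
  induction hn : cs.length v using Nat.strong_induction_on generalizing v with
  | _ n ih =>
    subst hn
    obtain ⟨z, hz1, hz2, hz3⟩ := h.exists_coatom hne
    by_cases hu : u = z
    · exact ⟨v, h, ble_refl cs v, by rw [hu, hz3]⟩
    · obtain ⟨z', h1, h2, h3⟩ := ih _ (by omega) hz1 hu rfl
      exact ⟨z', h1, h2.trans hz2, h3⟩

namespace IsSpecialMatching

variable {w : W} {M : W → W} (hM : IsSpecialMatching cs w M)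
include hM

lemma down_or_up {z : W} (hz : ble cs z w) :
    (ble cs (M z) z ∧ cs.length z = cs.length (M z) + 1) ∨
      (ble cs z (M z) ∧ cs.length (M z) = cs.length z + 1) := by
  simpa only [bcov_iff] using hM.2.2.1 z hz

lemma apply_mono {u v : W} (hv : ble cs v w) (huv : ble cs u v)
    (hl : cs.length v = cs.length u + 1) (hne : M u ≠ v) : ble cs (M u) (M v) :=
  hM.2.2.2 u v (huv.trans hv) hv (bcov_iff.2 ⟨huv, hl⟩) hne

lemma apply_le {u v : W} (hv : ble cs v w) (hd : cs.length (M v) < cs.length v)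
    (huv : ble cs u v) : ble cs (M u) v := by
  induction hn : cs.length v - cs.length u using Nat.strong_induction_on generalizing u with
  | _ n ih =>
    subst hn
    have hMv : ble cs (M v) v := by
      rcases hM.down_or_up hv with h | h
      · exact h.1
      · omega
    by_cases hne : u = v
    · rwa [hne]
    obtain ⟨z, h1, h2, h3⟩ := huv.exists_atom hne
    have hlt := huv.length_lt hne
    by_cases hz : M u = z
    · rwa [hz]
    · exact (hM.apply_mono (h2.trans hv) h1 h3 hz).trans (ih _ (by omega) h2 rfl)

lemma restrict {v : W} (hv : ble cs v w) (hd : cs.length (M v) < cs.length v) :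
    IsSpecialMatching cs v M :=
  ⟨fun _ h => hM.apply_le hv hd h, fun x h => hM.2.1 x (h.trans hv),
    fun x h => hM.2.2.1 x (h.trans hv),
    fun x y h h' => hM.2.2.2 x y (h.trans hv) (h'.trans hv)⟩

lemma apply_top : ble cs (M w) w ∧ cs.length w = cs.length (M w) + 1 := by
  rcases hM.down_or_up (ble_refl cs w) with h | h
  · exact h
  · have := (hM.1 w (ble_refl cs w)).length_le
    omega

lemma exists_apply_one : ∃ s, M 1 = cs.simple s := by
  rcases hM.down_or_up (one_ble cs w) with h | h
  · simp at h
  · exact cs.length_eq_one_iff.1 (by simpa using h.2)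

lemma apply_simple {s t : B} (hs : M 1 = cs.simple s) (ht : ble cs (cs.simple t) w)
    (hne : cs.simple t ≠ cs.simple s) :
    M (cs.simple t) = cs.simple s * cs.simple t ∨ M (cs.simple t) = cs.simple t * cs.simple s := by
  have h1 := hM.apply_mono ht (one_ble cs _) (by simp) (by rw [hs]; exact hne.symm)
  rw [hs] at h1
  rcases hM.down_or_up ht with h | h
  · have := h1.length_le
    have := h.2
    simp only [cs.length_simple] at *
    omega
  obtain ⟨h2, h3⟩ := h
  rw [cs.length_simple] at h3
  generalize M (cs.simple t) = z at *
  have hz : z ≠ 1 := by rintro rfl; simp at h3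
  obtain ⟨q, hq⟩ := cs.exists_rightDescent_of_ne_one hz
  have hq' := cs.isRightDescent_iff.1 hq
  obtain ⟨p, hp⟩ := cs.length_eq_one_iff.1 (show cs.length (z * cs.simple q) = 1 by omega)
  have ez : z = cs.simple p * cs.simple q := by rw [← hp]; simp
  have hmem : z ∈ parabolic cs {p, q} := by
    rw [ez]
    exact mul_mem (simple_mem_parabolic (by simp)) (simple_mem_parabolic (by simp))
  obtain ⟨j, hj, hjs⟩ := exists_of_simple_mem_parabolic (h1.mem_parabolic hmem)
  obtain ⟨k, hk, hkt⟩ := exists_of_simple_mem_parabolic (h2.mem_parabolic hmem)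
  rw [ez, ← hjs, ← hkt]
  rw [← hjs, ← hkt] at hne
  rcases hj with rfl | rfl <;> rcases hk with rfl | rfl
  · exact absurd rfl hne
  · exact Or.inl rfl
  · exact Or.inr rfl
  · exact absurd rfl hne

end IsSpecialMatching

lemma simple_braid (hsl : ∀ i j : B, i ≠ j → Mat.M i j = 2 ∨ Mat.M i j = 3) (b s : B)
    (hne : cs.simple b * cs.simple s ≠ cs.simple s * cs.simple b) :
    cs.simple b * cs.simple s * cs.simple b = cs.simple s * cs.simple b * cs.simple s := by
  have h := cs.simple_mul_simple_pow b s
  rcases hsl b s (by rintro rfl; exact hne rfl) with h2 | h3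
  · rw [show Mat b s = 2 from h2, pow_two, mul_eq_one_iff_eq_inv] at h
    exact absurd (by simpa using h) hne
  · rw [show Mat b s = 3 from h3, pow_succ, pow_two, mul_eq_one_iff_eq_inv] at h
    simp only [mul_inv_rev, cs.inv_simple] at h
    rw [← mul_left_inj (cs.simple s), ← h]
    simp [mul_assoc] at h ⊢

/-- In a simply laced Coxeter group, every special matching of a lower Bruhat interval is given
by inserting a simple reflection `s` in the middle of factorizations in `W_K * W_J`. -/
lemma IsSpecialMatching.exists_inserts
    (hsl : ∀ i j : B, i ≠ j → Mat.M i j = 2 ∨ Mat.M i j = 3) {w : W} {M : W → W}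
    (hM : IsSpecialMatching cs w M) :
    ∃ (s : B) (J K : Set B), s ∈ J ∧
      (∀ x ∈ parabolic cs K, ∀ y ∈ parabolic cs J, ble cs (x * y) w →
        M (x * y) = x * cs.simple s * y) ∧
      ∀ z, ble cs z w → ∃ x ∈ parabolic cs K, ∃ y ∈ parabolic cs J, z = x * y := by
  obtain ⟨s, hs⟩ := hM.exists_apply_one
  have hsw : ble cs (cs.simple s) w := hs ▸ hM.1 1 (one_ble cs w)
  let J : Set B := {i | ble cs (cs.simple i) w ∧
    (cs.simple i * cs.simple s = cs.simple s * cs.simple i ∨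
      M (cs.simple i) = cs.simple s * cs.simple i)}
  let K : Set B := {i | ble cs (cs.simple i) w ∧
    (cs.simple i * cs.simple s = cs.simple s * cs.simple i ∨
      M (cs.simple i) = cs.simple i * cs.simple s)}
  have memJ : s ∈ J := ⟨hsw, Or.inl rfl⟩
  have memK : s ∈ K := ⟨hsw, Or.inl rfl⟩
  have comm : ∀ i ∈ J, i ∈ K → cs.simple i * cs.simple s = cs.simple s * cs.simple i := by
    rintro i ⟨-, h1⟩ ⟨-, h2⟩
    rcases h1 with h1 | h1
    · exact h1
    · rcases h2 with h2 | h2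
      · exact h2
      · exact h2.symm.trans h1
  have satJ : ∀ i j, cs.simple i = cs.simple j → i ∈ J → j ∈ J := by
    rintro i j e ⟨h1, h2⟩
    exact ⟨e ▸ h1, e ▸ h2⟩
  have satK : ∀ i j, cs.simple i = cs.simple j → i ∈ K → j ∈ K := by
    rintro i j e ⟨h1, h2⟩
    exact ⟨e ▸ h1, e ▸ h2⟩
  have values : ∀ i, ble cs (cs.simple i) w →
      cs.simple i * cs.simple s ≠ cs.simple s * cs.simple i →
      M (cs.simple i) = cs.simple s * cs.simple i ∨
        M (cs.simple i) = cs.simple i * cs.simple s := fun i hi hne =>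
    hM.apply_simple hs hi (fun e => hne (by rw [e]))
  have partner : ∀ z, ble cs z w → InsertsAt cs M s J K z → InsertsAt cs M s J K (M z) := by
    rintro z hz ⟨x, hx, y, hy, e, e'⟩
    refine ⟨_, mul_mem hx (simple_mem_parabolic memK), y, hy, e', ?_⟩
    rw [hM.2.1 z hz, cs.simple_mul_simple_cancel_right, e]
  have main : ∀ n, ∀ v, ble cs v w → cs.length v = n → cs.length (M v) < cs.length v →
      InsertsAt cs M s J K (M v) := by
    intro n
    induction n using Nat.strong_induction_on with
    | _ n ih =>
    rintro v hv rfl hd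
    by_contra hnot
    have hMv := hM.restrict hv hd
    refine InsertionFailure.elim (cs := cs) (M := M) (w := v) (u := M v) (s := s) (J := J) (K := K)
      ⟨hMv.1, hMv.2.1, fun z hz => ?_, rfl, hMv.apply_top.2, hs, memJ, memK, comm, ?_, satJ, satK,
        ?_, ?_, ?_, ?_, ?_, ?_, hnot⟩
    · rcases hMv.down_or_up hz with h | h
      · exact Or.inl h.2
      · exact Or.inr h.2
    · intro i hi
      have hi' := hi.trans hv
      by_cases hc : cs.simple i * cs.simple s = cs.simple s * cs.simple i
      · exact Or.inl ⟨hi', Or.inl hc⟩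
      · rcases values i hi' hc with h | h
        · exact Or.inl ⟨hi', Or.inr h⟩
        · exact Or.inr ⟨hi', Or.inr h⟩
    · intro b hb hbJ
      have hb' := hb.trans hv
      have hc : ¬ cs.simple b * cs.simple s = cs.simple s * cs.simple b :=
        fun hc => hbJ ⟨hb', Or.inl hc⟩
      exact (values b hb' hc).resolve_left fun h => hbJ ⟨hb', Or.inr h⟩
    · intro b hb hbK
      have hb' := hb.trans hv
      have hc : ¬ cs.simple b * cs.simple s = cs.simple s * cs.simple b :=
        fun hc => hbK ⟨hb', Or.inl hc⟩
      exact (values b hb' hc).resolve_right fun h => hbK ⟨hb', Or.inr h⟩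
    · exact fun b hb hbJ hc => hbJ ⟨hb.1, Or.inl hc⟩
    · exact fun b hb hbK hc => hbK ⟨hb.1, Or.inl hc⟩
    · exact fun b => simple_braid hsl b s
    · intro z hz h1 h2
      have hzw := hz.trans hv
      rcases hMv.down_or_up hz with h | h
      · have := partner _ (hM.1 z hzw) (ih _ (hz.length_lt h1) z hzw rfl (by omega))
        rwa [hM.2.1 z hzw] at this
      · have hne : M z ≠ v := fun e => h2 (by rw [← e, hM.2.1 z hzw])
        have := ih _ ((hMv.1 z hz).length_lt hne) (M z) (hM.1 z hzw) rfl (by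
          rw [hM.2.1 z hzw]; omega)
        rwa [hM.2.1 z hzw] at this
  have all : ∀ z, ble cs z w → InsertsAt cs M s J K z := by
    intro z hz
    rcases hM.down_or_up hz with h | h
    · have := partner _ (hM.1 z hz) (main _ z hz rfl (by omega))
      rwa [hM.2.1 z hz] at this
    · have := main _ (M z) (hM.1 z hz) rfl (by rw [hM.2.1 z hz]; omega)
      rwa [hM.2.1 z hz] at this
  refine ⟨s, J, K, memJ, fun x hx y hy h => (all _ h).apply_mul comm satJ satK hx hy,
    fun z hz => ?_⟩
  obtain ⟨x, hx, y, hy, e, -⟩ := all z hz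
  exact ⟨x, hx, y, hy, e⟩

/-- A special matching of `[e,w]` is a left multiplication matching or commutes with one which
has a different value at `w`. -/
lemma IsSpecialMatching.eq_or_comm_simple_mul
    (hsl : ∀ i j : B, i ≠ j → Mat.M i j = 2 ∨ Mat.M i j = 3) {w : W} {M : W → W}
    (hM : IsSpecialMatching cs w M) :
    ∃ r, cs.length (cs.simple r * w) < cs.length w ∧
      ((∀ u, ble cs u w → M u = cs.simple r * u) ∨
        cs.simple r * w ≠ M w ∧
          ∀ u, ble cs u w → M (cs.simple r * u) = cs.simple r * M u) := by
  obtain ⟨s, J, K, hs, hval, hfac⟩ := hM.exists_inserts hsl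
  obtain ⟨x0, hx0, y0, hy0, e0⟩ := hfac w (ble_refl cs w)
  obtain ⟨x, y, hx, hxJ, hy, e⟩ := exists_factor_left_min hx0 hy0
  rw [← e0] at e
  by_cases hx1 : x = 1
  · have hu : ∀ u, ble cs u w → M u = cs.simple s * u := fun u hu => by
      have := hval 1 (one_mem _) u (hu.mem_parabolic (by rwa [e, hx1, one_mul]))
        (by rwa [one_mul])
      simpa using this
    refine ⟨s, ?_, Or.inl hu⟩
    rw [← hu w (ble_refl cs w)]
    have := hM.apply_top.2
    omega
  · obtain ⟨r, hr⟩ := cs.exists_leftDescent_of_ne_one hx1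
    rw [CoxeterSystem.IsLeftDescent] at hr
    have hrK := (simple_ble_of_left hr).mem_parabolic hx
    have hrw : cs.length (cs.simple r * w) < cs.length w := by
      rw [e, ← mul_assoc, length_mul_of_mem_WH (mul_mem_WH_of_left_descent hxJ hr) hy,
        length_mul_of_mem_WH hxJ hy]
      omega
    refine ⟨r, hrw, Or.inr ⟨fun h => ?_, fun u hu => ?_⟩⟩
    · rw [e, hval x hx y hy (e ▸ ble_refl cs w), ← mul_assoc] at h
      have := hxJ s hs
      rw [← mul_right_cancel h] at this
      omega
    · obtain ⟨x', hx', y', hy', rfl⟩ := hfac u hu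
      have h1 := hu.simple_mul_le hrw
      rw [← mul_assoc] at h1
      rw [← mul_assoc, hval _ (mul_mem hrK hx') y' hy' h1, hval x' hx' y' hy' hu]
      simp only [mul_assoc]

end SpecialMatchings

section RPolynomials

variable {B : Type*} {W : Type*} [Group W] {Mat : CoxeterMatrix B} {cs : CoxeterSystem Mat W}

/-- Left multiplication by a left descent of `w` is an `H`-special matching of `[e,w]`. -/
lemma isHSpecial_simple_mul (H : Set B) {w : W} {r : B}
    (hr : cs.length (cs.simple r * w) < cs.length w) :
    IsHSpecial cs H w (fun z => cs.simple r * z) := by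
  refine ⟨⟨fun x hx => hx.simple_mul_le hr, fun x _ => cs.simple_mul_simple_cancel_left r,
    fun x _ => ?_, fun u v hu hv huv hne => ?_⟩, fun u _ hu hc => ?_⟩
  · rcases cs.length_simple_mul x r with h | h
    · exact Or.inr (bcov_iff.2 ⟨ble_simple_mul_self cs (by omega), h⟩)
    · exact Or.inl (bcov_iff.2 ⟨simple_mul_ble_self cs (by omega), h.symm⟩)
  · obtain ⟨h, hl⟩ := bcov_iff.1 huv
    dsimp only
    rcases cs.length_simple_mul v r with hv' | hv'
    · have h1 : ble cs u (cs.simple r * v) := h.trans (ble_simple_mul_self cs (by omega))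
      exact h1.simple_mul_le (by rw [cs.simple_mul_simple_cancel_left]; omega)
    · rcases cs.length_simple_mul u r with hu' | hu'
      · have h1 := h.le_simple_mul (i := r) (by omega)
        have h2 := h1.eq_of_length_le (by omega)
        refine absurd ?_ hne
        rw [h2]
        exact cs.simple_mul_simple_cancel_left r
      · exact ((simple_mul_ble_self cs (by omega)).trans h).le_simple_mul (by
          rw [cs.simple_mul_simple_cancel_left]; omega)
  · have : cs.length u = cs.length (cs.simple r * u) + 1 := (bcov_iff.1 hc).2
    exact mul_mem_WH_of_left_descent hu (by omega)

lemma IsHSpecial.apply_mem {H : Set B} {w : W} {M : W → W} (hM : IsHSpecial cs H w M) {u : W}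
    (hu : ble cs u w) (hH : u ∈ WH cs H) (hd : cs.length (M u) < cs.length u) :
    M u ∈ WH cs H := by
  refine hM.2 u hu hH (bcov_iff.2 ?_)
  rcases hM.1.down_or_up hu with h | h
  · exact h
  · omega

section Commuting

variable {w : W} {M N : W → W} (hM : IsSpecialMatching cs w M) (hN : IsSpecialMatching cs w N)
  (hMN : ∀ u, ble cs u w → M (N u) = N (M u))
include hM hN hMN

lemma IsSpecialMatching.descent_iff {u : W} (hu : ble cs u w) (hne : M u ≠ N u) :
    cs.length (M (N u)) < cs.length (N u) ↔ cs.length (M u) < cs.length u := by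
  have hMu := hM.1 u hu
  have hNu := hN.1 u hu
  have e := hMN u hu
  have hMM := hM.down_or_up hu
  have hNN := hN.down_or_up hu
  have hMb := hM.down_or_up hNu
  have hNa := hN.down_or_up hMu
  rw [e] at hMb ⊢
  rcases hNN with hNN | hNN
  · have h1 := hM.apply_mono hu hNN.1 hNN.2 (fun h => hne (by
      rw [← congrArg M h, hM.2.1 _ hNu]))
    have := h1.length_le
    rw [e] at this
    omega
  · have h1 := hM.apply_mono hNu hNN.1 hNN.2 hne
    have := h1.length_le
    rw [e] at this
    omega

lemma IsSpecialMatching.apply_apply_mem_WH {H : Set B} {u : W} (hu : ble cs u w)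
    (hne : M u ≠ N u) (hMu : M u ∈ WH cs H) (hNu : N u ∈ WH cs H)
    (hMl : cs.length u < cs.length (M u)) (hNl : cs.length u < cs.length (N u)) :
    M (N u) ∈ WH cs H := by
  have e := hMN u hu
  have hMM := hM.down_or_up hu
  have hNN := hN.down_or_up hu
  have hMb := hM.down_or_up (hN.1 u hu)
  have hNa := hN.down_or_up (hM.1 u hu)
  have h1 := hM.descent_iff hN hMN hu hne
  have h2 := hN.descent_iff hM (fun v hv => (hMN v hv).symm) hu hne.symm
  rw [e] at hMb h1 ⊢
  generalize N (M u) = z at *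
  intro j hj
  by_contra hlt
  have hz : cs.length (z * cs.simple j) < cs.length z := by
    have := cs.length_mul_simple_ne z j
    omega
  have h3 : ble cs (M u) z := by
    rcases hNa with h | h
    · omega
    · exact h.1
  have h4 : ble cs (N u) z := by
    rcases hMb with h | h
    · omega
    · exact h.1
  have hz' := cs.isRightDescent_iff.1 hz
  have h5 := (h3.le_mul_simple (hMu j hj)).eq_of_length_le (by omega)
  have h6 := (h4.le_mul_simple (hNu j hj)).eq_of_length_le (by omega)
  exact hne (h5.trans h6.symm)

lemma IsSpecialMatching.mem_WH_iff {H : Set B} {u : W}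
    (hNH : ∀ v, ble cs v w → v ∈ WH cs H → cs.length (N v) < cs.length v → N v ∈ WH cs H)
    (hu : ble cs u w) (hne : M u ≠ N u) (hH : u ∈ WH cs H) (hNu : N u ∈ WH cs H)
    (hMl : ¬ cs.length (M u) < cs.length u) :
    M (N u) ∈ WH cs H ↔ M u ∈ WH cs H := by
  have hMN' : ∀ u, ble cs u w → N (M u) = M (N u) := fun v hv => (hMN v hv).symm
  have e := hMN u hu
  have hMw := hM.1 u hu
  have hNw := hN.1 u hu
  have h1 := hM.descent_iff hN hMN hu hne
  have h2 := hN.descent_iff hM hMN' hu hne.symm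
  have hMM := hM.down_or_up hu
  have hMb := hM.down_or_up hNw
  have hNN := hN.down_or_up hu
  have hNa := hN.down_or_up hMw
  by_cases hd : cs.length (N u) < cs.length u
  · constructor
    · intro h
      have h3 := hM.apply_apply_mem_WH hN hMN (H := H) hNw
        (by rw [hN.2.1 u hu]; intro h3; rw [e] at h3; apply hne
            have := hN.2.1 _ hMw
            rw [h3] at this; exact this.symm) h
        (by rwa [hN.2.1 u hu]) (by omega) (by rw [hN.2.1 u hu]; omega)
      rwa [hN.2.1 u hu] at h3
    · intro h
      rw [e]
      exact hNH _ hMw h (by omega)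
  · constructor
    · intro h
      rw [e] at h
      have h3 := hNH _ (hN.1 _ hMw) h (by rw [hN.2.1 _ hMw]; omega)
      rwa [hN.2.1 _ hMw] at h3
    · intro h
      exact hM.apply_apply_mem_WH hN hMN hu hne h hNu (by omega) (by omega)

end Commuting

variable (cs) in
/-- The right-hand side of the recursion for parabolic `R`-polynomials attached to `M`. -/
noncomputable def matchingOp (H : Set B) (x : Polynomial ℤ) (M : W → W) (φ : W → Polynomial ℤ)
    (u : W) : Polynomial ℤ :=
  if cs.length (M u) < cs.length u then φ (M u)
  else if M u ∈ WH cs H then (X - 1) * φ u + X * φ (M u)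
  else (X - 1 - x) * φ u

lemma matchingOp_congr {H : Set B} {x : Polynomial ℤ} {M M' : W → W} {φ ψ : W → Polynomial ℤ}
    {u : W} (hM : M u = M' u) (hd : cs.length (M u) < cs.length u → M u ∈ WH cs H)
    (hu : φ u = ψ u) (hMu : M u ∈ WH cs H → φ (M u) = ψ (M u)) :
    matchingOp cs H x M φ u = matchingOp cs H x M' ψ u := by
  simp only [matchingOp, ← hM, hu]
  split_ifs with h1 h2
  · exact hMu (hd h1)
  · rw [hMu h2]
  · rfl

lemma matchingOp_comm {H : Set B} (x : Polynomial ℤ) {w : W} {M N : W → W}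
    (hM : IsHSpecial cs H w M) (hN : IsHSpecial cs H w N)
    (hMN : ∀ u, ble cs u w → M (N u) = N (M u)) (φ : W → Polynomial ℤ) {u : W}
    (hu : ble cs u w) (hH : u ∈ WH cs H) :
    matchingOp cs H x M (matchingOp cs H x N φ) u =
      matchingOp cs H x N (matchingOp cs H x M φ) u := by
  by_cases hne : M u = N u
  · simp only [matchingOp, hne, hMN u hu, hN.1.2.1 u hu]
  · have hMN' : ∀ u, ble cs u w → N (M u) = M (N u) := fun v hv => (hMN v hv).symm
    have a1 := hM.1.descent_iff hN.1 hMN hu hne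
    have a2 := hN.1.descent_iff hM.1 hMN' hu (Ne.symm hne)
    have b1 := hM.1.mem_WH_iff hN.1 hMN (H := H) (fun v => hN.apply_mem) hu hne hH
    have b2 := hN.1.mem_WH_iff hM.1 hMN' (H := H) (fun v => hM.apply_mem) hu (Ne.symm hne) hH
    have c1 := hM.apply_mem hu hH
    have c2 := hN.apply_mem hu hH
    rw [hMN u hu] at a1 b1
    simp only [matchingOp, hMN u hu, a1, a2]
    by_cases d1 : cs.length (M u) < cs.length u
    · have m1 := c1 d1
      by_cases d2 : cs.length (N u) < cs.length u
      · simp [d1, d2]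
      · simp [d1, d2, b2 m1 d2]
    · by_cases d2 : cs.length (N u) < cs.length u
      · simp [d1, d2, b1 (c2 d2) d1]
      · by_cases m1 : M u ∈ WH cs H
        · by_cases m2 : N u ∈ WH cs H
          · simp only [d1, d2, m1, m2, b1 m2 d1, if_true, if_false]
            ring
          · simp only [d1, d2, m1, m2, b2 m1 d2, if_true, if_false]
            ring
        · by_cases m2 : N u ∈ WH cs H
          · simp only [d1, d2, m1, m2, b1 m2 d1, if_true, if_false]
            ring
          · simp [d1, d2, m1, m2]

namespace IsDeodharFamily

variable {H : Set B} {x : Polynomial ℤ} {ρ : W → W → Polynomial ℤ}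
  (hρ : IsDeodharFamily cs H x ρ)
include hρ

lemma eq_matchingOp_of_not_ble {v : W} {M : W → W} (hv : v ∈ WH cs H)
    (hM : IsHSpecial cs H v M) {u : W} (hu : u ∈ WH cs H)
    (hd : cs.length (M u) < cs.length u → M u ∈ WH cs H)
    (hinv : M (M u) = u) (hup : ¬ cs.length (M u) < cs.length u → ble cs u (M u))
    (hle : ¬ ble cs u v) : ρ u v = matchingOp cs H x M (fun z => ρ z (M v)) u := by
  have hMv := hM.1.apply_top
  have hMvH := hM.apply_mem (ble_refl cs v) hv (by omega)
  have h1 : ¬ ble cs u (M v) := fun h => hle (h.trans hMv.1)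
  rw [hρ.1 u hu v hv hle]
  simp only [matchingOp]
  split_ifs with h2 h3
  · rw [hρ.1 _ (hd h2) _ hMvH]
    intro h
    have := hM.1.1 _ (h.trans hMv.1)
    rw [hinv] at this
    exact hle this
  · rw [hρ.1 u hu _ hMvH h1, hρ.1 _ h3 _ hMvH (fun h => h1 ((hup h2).trans h))]
    simp
  · rw [hρ.1 u hu _ hMvH h1]
    simp

lemma eq_matchingOp_simple_mul {w u : W} {r : B} (hw : w ∈ WH cs H) (hu : u ∈ WH cs H)
    (hr : cs.length (cs.simple r * w) < cs.length w) :
    ρ u w = matchingOp cs H x (fun z => cs.simple r * z) (fun z => ρ z (cs.simple r * w)) u := by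
  by_cases hle : ble cs u w
  · by_cases hne : u = w
    · subst hne
      rw [matchingOp, if_pos hr, hρ.2.1 _ hu, hρ.2.1 _ (mul_mem_WH_of_left_descent hu hr)]
    · obtain ⟨h1, h2, h3⟩ := hρ.2.2 u hu w hw ⟨hle, hne⟩ r hr
      have hlen := cs.length_simple_mul_ne u r
      simp only [matchingOp]
      split_ifs with h4 h5
      · exact h1 h4
      · exact h2 (by omega) h5
      · exact h3 (by omega) h5
  · refine hρ.eq_matchingOp_of_not_ble hw (isHSpecial_simple_mul H hr) hu
      (mul_mem_WH_of_left_descent hu) (cs.simple_mul_simple_cancel_left r) (fun h => ?_) hle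
    have := cs.length_simple_mul_ne u r
    exact ble_simple_mul_self cs (by omega)

/-- The parabolic `R`-polynomials satisfy the recursion attached to any `H`-special matching. -/
lemma eq_matchingOp (hsl : ∀ i j : B, i ≠ j → Mat.M i j = 2 ∨ Mat.M i j = 3)
    {w : W} {M : W → W} (hw : w ∈ WH cs H) (hM : IsHSpecial cs H w M) {u : W}
    (hu : u ∈ WH cs H) (hle : ble cs u w) :
    ρ u w = matchingOp cs H x M (fun z => ρ z (M w)) u := by
  induction hn : cs.length w using Nat.strong_induction_on generalizing w u with
  | _ n ih =>
    subst hn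
    obtain ⟨r, hr, hcase⟩ := hM.1.eq_or_comm_simple_mul hsl
    rcases hcase with hM' | ⟨hne, hcomm⟩
    · rw [hρ.eq_matchingOp_simple_mul hw hu hr, hM' w (ble_refl cs w)]
      exact matchingOp_congr (hM' u hle).symm (mul_mem_WH_of_left_descent hu) rfl fun _ => rfl
    · have hN := isHSpecial_simple_mul (cs := cs) H hr
      set N : W → W := fun z => cs.simple r * z with hNdef
      have hMN' : ∀ u, ble cs u w → N (M u) = M (N u) := fun v hv => (hcomm v hv).symm
      have hww := ble_refl cs w
      have hMw := hM.1.apply_top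
      have hMwH := hM.apply_mem hww hw (by omega)
      have hNwH := hN.apply_mem hww hw hr
      have d1 := (hM.1.descent_iff hN.1 hcomm hww (Ne.symm hne)).2 (by omega)
      have d2 := (hN.1.descent_iff hM.1 hMN' hww hne).2 hr
      have hNw : ble cs (N w) w := simple_mul_ble_self cs hr
      have hMNw : IsHSpecial cs H (N w) M :=
        ⟨hM.1.restrict hNw d1, fun z hz => hM.2 z (hz.trans hNw)⟩
      have key : ∀ z ∈ WH cs H, ble cs z w →
          ρ z (N w) = matchingOp cs H x M (fun z => ρ z (M (N w))) z := by
        intro z hz hzw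
        by_cases hzN : ble cs z (N w)
        · exact ih _ hr hNwH hMNw hz hzN rfl
        · refine hρ.eq_matchingOp_of_not_ble hNwH hMNw hz (hM.apply_mem hzw hz)
            (hM.1.2.1 z hzw) (fun h => ?_) hzN
          rcases hM.1.down_or_up hzw with h' | h'
          · omega
          · exact h'.1
      calc ρ u w = matchingOp cs H x N (fun z => ρ z (N w)) u :=
            hρ.eq_matchingOp_simple_mul hw hu hr
        _ = matchingOp cs H x N (matchingOp cs H x M fun z => ρ z (M (N w))) u :=
            matchingOp_congr rfl (hN.apply_mem hle hu) (key u hu hle)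
              fun h => key _ h (hN.1.1 u hle)
        _ = matchingOp cs H x M (matchingOp cs H x N fun z => ρ z (M (N w))) u :=
            matchingOp_comm x hN hM hMN' _ hle hu
        _ = matchingOp cs H x M (fun z => ρ z (M w)) u := by
            have key2 : ∀ z ∈ WH cs H,
                matchingOp cs H x N (fun z => ρ z (M (N w))) z = ρ z (M w) := fun z hz => by
              rw [hρ.eq_matchingOp_simple_mul hMwH hz d2, hcomm w hww]
            exact matchingOp_congr rfl (hM.apply_mem hle hu) (key2 u hu) fun h => key2 _ h

end IsDeodharFamily

lemma bcov.covInB {O : Set W} {u v : W} (h : bcov cs u v) (hu : u ∈ O) (hv : v ∈ O) :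
    CovInB cs O u v := by
  refine ⟨hu, hv, h.1, fun z _ hz => ?_⟩
  rcases h.2 z hz.1.1 hz.2.1 with e | e
  · exact hz.1.2 e.symm
  · exact hz.2.2 e

end RPolynomials

/-- Let `(W,S)` be a simply laced Coxeter system, `H ⊆ S` and
`x ∈ {q, -1}`.  For every refinement `ℳ` of the pircon `W^H` contained in `SPM^H`, the
Kazhdan–Lusztig `R^x`-polynomials of the refined pircon `(W^H, ℳ)` coincide with
Deodhar's parabolic Kazhdan–Lusztig `R`-polynomials of type `x`:
`R^x_{u,w} = R^{H,x}_{u,w}` for all `u, w ∈ W^H`. -/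
theorem stmt19 {B : Type*} {W : Type*} [Group W] {Mat : CoxeterMatrix B}
    (cs : CoxeterSystem Mat W)
    (hsl : ∀ i j : B, i ≠ j → Mat.M i j = 2 ∨ Mat.M i j = 3) (H : Set B)
    (x : Polynomial ℤ) (hx : x = X ∨ x = -1)
    (ℳ : W → W → W)
    (hℳ1 : ∀ v ∈ WH cs H, v ≠ 1 →
      IsSPMOnSet cs {z : W | z ∈ WH cs H ∧ ble cs z v} v (ℳ v))
    (hℳ2 : ∀ v ∈ WH cs H, v ≠ 1 → (v, ℳ v) ∈ SPMH cs H)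
    (R : W → W → Polynomial ℤ) (hR : IsKLFamilyOnSet cs (WH cs H) ℳ x R)
    (RH : W → W → Polynomial ℤ) (hRH : IsDeodharFamily cs H x RH) :
    ∀ u ∈ WH cs H, ∀ w ∈ WH cs H, R u w = RH u w := by
  intro u hu w hw
  induction hn : cs.length w using Nat.strong_induction_on generalizing u w with
  | _ n ih =>
    subst hn
    by_cases hle : ble cs u w
    swap
    · rw [hR.2.1 u hu w hw hle, hRH.1 u hu w hw hle]
    by_cases hne : u = w
    · rw [hne, hR.1 w hw, hRH.2.1 w hw]
    have hw1 : w ≠ 1 := by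
      rintro rfl
      simpa using hle.length_lt hne
    obtain ⟨w', M, e, -, -, hM⟩ := hℳ2 w hw hw1
    obtain ⟨rfl, hℳw⟩ := Prod.mk.inj e
    have htop := hM.1.apply_top
    have hMw := hM.apply_mem (ble_refl cs w) hw (by omega)
    have hℳtop : ℳ w w = M w := by rw [hℳw, MHmap, if_pos hMw]
    have hIH : ∀ z ∈ WH cs H, R z (M w) = RH z (M w) := fun z hz =>
      ih _ (by omega) z hz _ hMw rfl
    obtain ⟨h1, h2, h3⟩ := hR.2.2 u hu w hw ⟨hle, hne⟩
    rw [hRH.eq_matchingOp hsl hw hM hu hle, matchingOp]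
    rw [hℳtop] at h1 h2 h3
    split_ifs with hd hMu
    · have hMu := hM.apply_mem hle hu hd
      have hℳu : ℳ w u = M u := by rw [hℳw, MHmap, if_pos hMu]
      rw [hℳu] at h1
      rw [h1 (bcov.covInB (bcov_iff.2 ?_) hMu hu), hIH _ hMu]
      rcases hM.1.down_or_up hle with h | h
      · exact h
      · omega
    · have hℳu : ℳ w u = M u := by rw [hℳw, MHmap, if_pos hMu]
      rw [hℳu] at h2
      rw [h2 (bcov.covInB (bcov_iff.2 ?_) hu hMu), hIH _ hMu, hIH u hu]
      rcases hM.1.down_or_up hle with h | h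
      · omega
      · exact h
    · have hℳu : ℳ w u = u := by rw [hℳw, MHmap, if_neg hMu]
      rw [h3 hℳu, hIH u hu]
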